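/- Let f : ℂ → ℂ be entire such that f, f* ∈ AP(ℍ) (where f*(z) = conj(f(conj z))) and both spec(f) and spec(f*) are bounded from below. If f has finite order, i.e. inf{ρ > 0 : limsup_{|z|→∞} log⁺|f(z)|/|z|^ρ < ∞} < ∞, then f has finite exponential type τ = limsup_{|z|→∞} log|f(z)|/|z| < ∞. In this case f and f* are of bounded type on ℍ, f is bounded on the real line, |f(x+iy)| ≤ M e^{τ|y|} for all x, y ∈ ℝ where M = sup_{x∈ℝ} |f(x)| and τ = max{ϑ(f), ϑ(f*)}; moreover ℰf(λ) = conj(ℰ(f*)(−λ)) for all λ ∈ ℝ and spec(f) = −spec(f*) ⊂ [−τ/(2π), τ/(2π)]. If in addition spec(f) is locally finite, then f is a trigonometric polynomial. -/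

import Mathlib

open MeasureTheory Complex Filter Topology Set
open scoped ENNReal

noncomputable section

/-- The open upper half-plane, as a subset of `ℂ`. -/
def UHP : Set ℂ := {z : ℂ | 0 < z.im}

/-- A relatively dense subset of `ℝ`. -/
def RelDense (τ : Set ℝ) : Prop := ∃ l > (0:ℝ), ∀ x : ℝ, ∃ t ∈ τ, x < t ∧ t < x + l

/-- Bohr almost periodic continuous functions on `ℝ`. -/
def APR (f : ℝ → ℂ) : Prop :=
  Continuous f ∧ ∀ ε > (0:ℝ), RelDense {t : ℝ | ∀ x : ℝ, ‖f x - f (x + t)‖ ≤ ε}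

/-- Holomorphic almost periodic functions on the upper half-plane. -/
def APH (f : ℂ → ℂ) : Prop :=
  DifferentiableOn ℂ f UHP ∧
  ∀ α β ε : ℝ, 0 < α → α < β → 0 < ε →
    ∃ τ : Set ℝ, RelDense τ ∧
      ∀ t ∈ τ, ∀ z : ℂ, α < z.im → z.im < β → ‖f z - f (z + (t : ℂ))‖ ≤ ε

/-- `HasMeanAt f y lam c` : the mean `(1/2T)∫_{-T+iy}^{T+iy} f(z) e^{-2πiλz} dz` tends to `c`. -/
def HasMeanAt (f : ℂ → ℂ) (y lam : ℝ) (c : ℂ) : Prop :=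
  Tendsto (fun T : ℝ => (1 / (2 * (T : ℂ))) *
      ∫ x in (-T)..T, f ((x : ℂ) + (y : ℂ) * Complex.I) *
        Complex.exp (-(2 * (Real.pi : ℂ) * Complex.I * (lam : ℂ) * ((x : ℂ) + (y : ℂ) * Complex.I))))
    atTop (𝓝 c)

/-- `HasMeanR f lam c` : the Bohr mean `(1/2T)∫_{-T}^{T} f(x) e^{-2πiλx} dx` tends to `c`. -/
def HasMeanR (f : ℝ → ℂ) (lam : ℝ) (c : ℂ) : Prop :=
  Tendsto (fun T : ℝ => (1 / (2 * (T : ℂ))) *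
      ∫ x in (-T)..T, f x *
        Complex.exp (-(2 * (Real.pi : ℂ) * Complex.I * (lam : ℂ) * (x : ℂ))))
    atTop (𝓝 c)

/-- The spectrum of a function on the upper half-plane: frequencies where the mean is not `0`. -/
def specH (f : ℂ → ℂ) : Set ℝ := {lam : ℝ | ∃ y > (0:ℝ), ¬ HasMeanAt f y lam 0}

/-- A locally finite subset of `ℝ`. -/
def LocFinSet (S : Set ℝ) : Prop := ∀ a b : ℝ, (S ∩ Set.Ioo a b).Finite

/-- A uniformly discrete subset of `ℝ`. -/
def UnifDiscrete (S : Set ℝ) : Prop :=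
  ∃ d > (0:ℝ), ∀ x ∈ S, ∀ y ∈ S, x ≠ y → d ≤ |x - y|

/-- Locally summable coefficient functions. -/
def LocSummable (a : ℝ → ℂ) : Prop :=
  (Function.support a).Countable ∧
  ∀ T > (0:ℝ), Summable (Set.indicator (Set.Icc (-T) T) fun l => ‖a l‖)

/-- Exponential growth of a coefficient function. -/
def ExpGrowth (a : ℝ → ℂ) : Prop :=
  ∃ c > (0:ℝ), Summable fun lam : ℝ => ‖a lam‖ * Real.exp (-c * |lam|)

/-- `a(-λ) = conj (a(λ))`. -/
def Antipodal (a : ℝ → ℂ) : Prop := ∀ lam : ℝ, a (-lam) = (starRingEnd ℂ) (a lam)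

/-- The Fourier transform `φ̂(ξ) = ∫ φ(x) e^{-2πixξ} dx`. -/
def FT (φ : ℝ → ℂ) (ξ : ℝ) : ℂ :=
  ∫ x : ℝ, φ x * Complex.exp (-(2 * (Real.pi : ℂ) * Complex.I * (x : ℂ) * (ξ : ℂ)))

/-- A complex-valued measure on `ℝ`, encoded by its total variation `ν` together with a
unimodular density `w`, so that `dμ = w dν` and `|μ| = ν`. -/
structure CMeasure where
  ν : Measure ℝ
  w : ℝ → ℂ
  meas : Measurable w
  unit : ∀ᵐ t ∂ν, ‖w t‖ = 1

/-- Integration against a complex measure. -/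
def CMeasure.integral (μ : CMeasure) (φ : ℝ → ℂ) : ℂ := ∫ t, φ t * μ.w t ∂μ.ν

/-- Strongly tempered: every Schwartz function is `|μ|`-integrable. -/
def CMeasure.IsStronglyTempered (μ : CMeasure) : Prop :=
  ∀ φ : SchwartzMap ℝ ℂ, Integrable (fun t => φ t) μ.ν

/-- Real-valued complex measure. -/
def CMeasure.RealValued (μ : CMeasure) : Prop := ∀ᵐ t ∂μ.ν, (μ.w t).im = 0

/-- Nonnegative complex measure. -/
def CMeasure.Nonneg (μ : CMeasure) : Prop := ∀ᵐ t ∂μ.ν, μ.w t = 1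

/-- `deg(μ) ≤ n` : `∫ (1+t²)^{-n/2} d|μ| < ∞`. -/
def CMeasure.DegLE (μ : CMeasure) (n : ℕ) : Prop :=
  Integrable (fun t : ℝ => (1 + t ^ 2) ^ (-(n : ℝ) / 2)) μ.ν

/-- The mass `μ({x})` of an atom. -/
def CMeasure.atom (μ : CMeasure) (x : ℝ) : ℂ := ∫ t in {x}, μ.w t ∂μ.ν

/-- The (closed) support of a measure on `ℝ`. -/
def measSupport (ν : Measure ℝ) : Set ℝ := {x : ℝ | ∀ U ∈ 𝓝 x, ν U ≠ 0}

/-- `(μ, a)` is a Fourier summation pair. -/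
def IsFSPair (μ : CMeasure) (a : ℝ → ℂ) : Prop :=
  μ.IsStronglyTempered ∧ LocSummable a ∧
    ∀ φ : ℝ → ℂ, ContDiff ℝ (⊤ : ℕ∞) φ → HasCompactSupport φ →
      μ.integral (FT φ) = ∑' lam : ℝ, a lam * φ lam

/-- Trigonometric polynomials. -/
def IsTrigPoly (f : ℂ → ℂ) : Prop :=
  ∃ (N : ℕ) (p : Fin N → ℂ) (θ : Fin N → ℝ),
    ∀ z : ℂ, f z = ∑ n, p n * Complex.exp (2 * (Real.pi : ℂ) * Complex.I * (θ n : ℂ) * z)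

/-- Functions of bounded type on the upper half-plane. -/
def BoundedType (g : ℂ → ℂ) : Prop :=
  ∃ P Q : ℂ → ℂ, DifferentiableOn ℂ P UHP ∧ DifferentiableOn ℂ Q UHP ∧
    (∃ C : ℝ, ∀ z ∈ UHP, ‖P z‖ ≤ C) ∧ (∃ C : ℝ, ∀ z ∈ UHP, ‖Q z‖ ≤ C) ∧
    (∀ z ∈ UHP, Q z ≠ 0) ∧ ∀ z ∈ UHP, g z = P z / Q z

/-- Mean type `ϑ(g) = limsup_{y→∞} log|g(iy)|/y`. -/
def MeanType (g : ℂ → ℂ) : ℝ :=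
  Filter.limsup (fun y : ℝ => Real.log ‖g ((y : ℂ) * Complex.I)‖ / y) atTop

/-- `E*(z) = conj (E (conj z))`. -/
def fstar (E : ℂ → ℂ) : ℂ → ℂ := fun z => (starRingEnd ℂ) (E ((starRingEnd ℂ) z))

/-- Hermite–Biehler class: entire with `|E*(z)| < |E(z)|` on the upper half-plane. -/
def HB (E : ℂ → ℂ) : Prop := Differentiable ℂ E ∧ ∀ z ∈ UHP, ‖fstar E z‖ < ‖E z‖

/-- `A = (E* + E)/2`. -/
def HBA (E : ℂ → ℂ) : ℂ → ℂ := fun z => (fstar E z + E z) / 2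

/-- `B = (E* - E)/(2i)`. -/
def HBB (E : ℂ → ℂ) : ℂ → ℂ := fun z => (fstar E z - E z) / (2 * Complex.I)

/-- `φ` is a phase function for `E`, with derivative `φd > 0`. -/
def IsPhaseFor (φ φd : ℝ → ℝ) (E : ℂ → ℂ) : Prop :=
  (∀ x : ℝ, HasDerivAt φ (φd x) x) ∧ (∀ x : ℝ, 0 < φd x) ∧
    ∀ x : ℝ, (Complex.exp (Complex.I * (φ x : ℂ)) * E (x : ℂ)).im = 0

/-- The points where `φ ≡ 0 (mod π)`. -/
def phaseZeros (φ : ℝ → ℝ) : Set ℝ := {γ : ℝ | ∃ k : ℤ, φ γ = k * Real.pi}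

/-- The nonnegative measure `2π Σ_{φ(γ)≡0 (mod π)} (1/φ'(γ)) δ_γ`. -/
def phaseMeasure (φ φd : ℝ → ℝ) : Measure ℝ :=
  Measure.sum fun γ : phaseZeros φ =>
    (ENNReal.ofReal (2 * Real.pi / φd (γ : ℝ))) • Measure.dirac (γ : ℝ)

/-- `μ` is an `ℕ`-valued nonnegative measure. -/
def CMeasure.NValued (μ : CMeasure) : Prop :=
  μ.Nonneg ∧ ∃ (Λ : Set ℝ) (m : ℝ → ℕ), LocFinSet Λ ∧ (∀ γ ∈ Λ, 0 < m γ) ∧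
    μ.ν = Measure.sum fun γ : Λ => (m (γ : ℝ) : ℝ≥0∞) • Measure.dirac (γ : ℝ)

/-- Bounded on every horizontal substrip of the upper half-plane. -/
def BddOnStrips (f : ℂ → ℂ) : Prop :=
  ∀ ε > (0:ℝ), ∃ C : ℝ, ∀ z : ℂ, ε < z.im → z.im < 1/ε → ‖f z‖ ≤ C

/-- The Fejér-type partial sums in formula (eq:fdef). -/
def fdefSum (a : ℝ → ℂ) (T : ℝ) (z : ℂ) : ℂ :=
  a 0 / 2 + ∑' lam : ℝ,
    Set.indicator (Set.Ioo (0 : ℝ) T)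
      (fun l => a l * (1 - (l : ℂ) / (T : ℂ)) *
        Complex.exp (2 * (Real.pi : ℂ) * Complex.I * (l : ℂ) * z)) lam

/-! ### Bohr almost periodic functions on the line -/

/-- The oscillation `x ↦ e^{-2πiλx}`. -/
def osc (lam x : ℝ) : ℂ :=
  Complex.exp (-(2 * (Real.pi : ℂ) * Complex.I * (lam : ℂ) * (x : ℂ)))

lemma norm_osc (lam x : ℝ) : ‖osc lam x‖ = 1 := by
  rw [osc, Complex.norm_exp]
  simp

lemma continuous_osc (lam : ℝ) : Continuous (osc lam) := by
  unfold osc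
  fun_prop

lemma osc_add (lam x y : ℝ) : osc lam (x + y) = osc lam x * osc lam y := by
  simp only [osc, ← Complex.exp_add]
  push_cast
  ring_nf

lemma norm_osc_sub_osc_le (lam mu x : ℝ) :
    ‖osc lam x - osc mu x‖ ≤ 2 * Real.pi * |lam - mu| * |x| := by
  have h : osc lam x - osc mu x
      = osc mu x * (Complex.exp (Complex.I * ((-(2 * Real.pi * (lam - mu) * x) : ℝ) : ℂ)) - 1) := by
    rw [mul_sub, mul_one, osc, osc, ← Complex.exp_add]
    congr 2
    push_cast
    ring
  rw [h, norm_mul, norm_osc, one_mul]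
  refine (Real.norm_exp_I_mul_ofReal_sub_one_le).trans ?_
  rw [Real.norm_eq_abs, abs_neg, abs_mul, abs_mul, abs_mul, abs_of_pos Real.pi_pos,
    abs_of_pos (two_pos : (0 : ℝ) < 2)]

lemma integral_osc_shift (lam a b t : ℝ) (g : ℝ → ℂ) :
    ∫ x in (a + t)..(b + t), g x * osc lam x
      = osc lam t * ∫ x in a..b, g (x + t) * osc lam x := by
  rw [← intervalIntegral.integral_comp_add_right (fun x => g x * osc lam x) t,
    ← intervalIntegral.integral_const_mul]
  congr 1
  ext x
  rw [osc_add]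
  ring

lemma APR.bounded {g : ℝ → ℂ} (hg : APR g) : ∃ B > (0 : ℝ), ∀ x, ‖g x‖ ≤ B := by
  obtain ⟨l, hl, h⟩ := hg.2 1 one_pos
  obtain ⟨C, hC⟩ := (isCompact_Icc (a := (0 : ℝ)) (b := l)).exists_bound_of_continuousOn
    hg.1.continuousOn
  refine ⟨max C 0 + 1, by positivity, fun x => ?_⟩
  obtain ⟨t, ht, h1, h2⟩ := h (-x)
  have h3 := hC (x + t) ⟨by linarith, by linarith⟩
  have h4 := norm_add_le (g x - g (x + t)) (g (x + t))
  rw [sub_add_cancel] at h4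
  have := ht x
  have := le_max_left C 0
  linarith

lemma APR.unifCont {g : ℝ → ℂ} (hg : APR g) {ε : ℝ} (hε : 0 < ε) :
    ∃ δ > (0 : ℝ), ∀ x y, |x - y| ≤ δ → ‖g x - g y‖ ≤ ε := by
  obtain ⟨l, hl, h⟩ := hg.2 (ε / 3) (by positivity)
  have huc := (isCompact_Icc (a := (-1 : ℝ)) (b := l + 1)).uniformContinuousOn_of_continuous
    hg.1.continuousOn
  rw [Metric.uniformContinuousOn_iff] at huc
  obtain ⟨δ, hδ, hd⟩ := huc (ε / 3) (by positivity)
  refine ⟨min (δ / 2) 1, by positivity, fun x y hxy => ?_⟩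
  obtain ⟨t, ht, h1, h2⟩ := h (-x)
  have hxy1 := hxy.trans (min_le_left _ _)
  have hxy2 := abs_le.1 (hxy.trans (min_le_right _ _))
  have h3 := hd (x + t) ⟨by linarith, by linarith⟩ (y + t) ⟨by linarith, by linarith⟩ (by
    rw [Real.dist_eq]
    have : x + t - (y + t) = x - y := by ring
    rw [this]
    linarith)
  rw [dist_eq_norm] at h3
  have e : g x - g y = (g x - g (x + t)) + (g (x + t) - g (y + t)) - (g y - g (y + t)) := by ring
  rw [e]
  have h4 := ht x
  have h5 := ht y
  calc _ ≤ ‖g x - g (x + t)‖ + ‖g (x + t) - g (y + t)‖ + ‖g y - g (y + t)‖ :=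
        (norm_sub_le _ _).trans (add_le_add_left (norm_add_le _ _) _)
    _ ≤ _ := by linarith

/-! ### Uniform smallness of oscillatory integrals -/

lemma norm_integral_le_of_windows {h : ℝ → ℂ} (hc : Continuous h) {B ε p : ℝ} (hp : 0 < p)
    (hε : 0 ≤ ε) (hB : ∀ x, ‖h x‖ ≤ B) (hw : ∀ a, ‖∫ x in a..(a + p), h x‖ ≤ ε * p) (a x : ℝ)
    (hx : 0 ≤ x) : ‖∫ u in a..(a + x), h u‖ ≤ ε * x + B * p := by
  have hi : ∀ a b, IntervalIntegrable h volume a b := fun a b => hc.intervalIntegrable a b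
  have key : ∀ n : ℕ, ‖∫ u in a..(a + n * p), h u‖ ≤ ε * (n * p) := by
    intro n
    induction n with
    | zero => simp
    | succ n ih =>
      have e : a + ((n + 1 : ℕ) : ℝ) * p = (a + n * p) + p := by push_cast; ring
      rw [e, ← intervalIntegral.integral_add_adjacent_intervals (hi a (a + n * p)) (hi _ _)]
      refine (norm_add_le _ _).trans ?_
      have := hw (a + n * p)
      push_cast
      linarith
  set n := ⌊x / p⌋₊ with hn
  have h1 : (n : ℝ) * p ≤ x := by
    rw [← le_div_iff₀ hp]
    exact Nat.floor_le (by positivity)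
  have h2 : x < (n + 1) * p := by
    rw [← div_lt_iff₀ hp]
    exact Nat.lt_floor_add_one _
  rw [← intervalIntegral.integral_add_adjacent_intervals (hi a (a + n * p)) (hi _ _)]
  refine (norm_add_le _ _).trans (add_le_add ((key n).trans (by gcongr)) ?_)
  have hB0 : 0 ≤ B := (norm_nonneg _).trans (hB 0)
  refine (intervalIntegral.norm_integral_le_of_norm_le_const (fun u _ => hB u)).trans ?_
  gcongr
  rw [abs_of_nonneg (by linarith)]
  linarith

/-- The mean of `g` against `osc lam` vanishes along arbitrarily long windows. -/
def FreqMeanZero (g : ℝ → ℂ) (lam : ℝ) : Prop :=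
  ∀ ε > (0 : ℝ), ∃ᶠ T in atTop, ‖∫ x in (-T)..T, g x * osc lam x‖ ≤ ε * T

lemma windows_near {g : ℝ → ℂ} (hg : APR g) {lam : ℝ} (hm : FreqMeanZero g lam) {ε : ℝ}
    (hε : 0 < ε) : ∃ δ > (0 : ℝ), ∃ p > (0 : ℝ), ∀ mu, |mu - lam| ≤ δ → ∀ a,
      ‖∫ x in a..(a + p), g x * osc mu x‖ ≤ ε * p := by
  obtain ⟨B, hB0, hB⟩ := hg.bounded
  obtain ⟨l, hl, hrel⟩ := hg.2 (ε / 4) (by positivity)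
  obtain ⟨T, hT, hTl⟩ := ((hm (ε / 4) (by positivity)).and_eventually
    (eventually_ge_atTop (max 1 (8 * B * l / ε)))).exists
  have hT1 : 1 ≤ T := (le_max_left _ _).trans hTl
  have hT2 : 8 * B * l / ε ≤ T := (le_max_right _ _).trans hTl
  rw [div_le_iff₀ hε] at hT2
  have hT0 : 0 < T := by linarith
  have hcont : ∀ nu s, Continuous fun x => g (x + s) * osc nu x := fun nu s =>
    (hg.1.comp (continuous_add_const s)).mul (continuous_osc nu)
  have hgint : ∀ nu s a b, IntervalIntegrable (fun x => g (x + s) * osc nu x) volume a b :=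
    fun nu s a b => (hcont nu s).intervalIntegrable a b
  have hcont' : Continuous fun x => g x * osc lam x := hg.1.mul (continuous_osc lam)
  have hgint' : ∀ a b, IntervalIntegrable (fun x => g x * osc lam x) volume a b :=
    fun a b => hcont'.intervalIntegrable a b
  have hbd : ∀ x, ‖g x * osc lam x‖ ≤ B := fun x => by
    rw [norm_mul, norm_osc, mul_one]; exact hB x
  -- windows at the frequency `lam`
  have h1 : ∀ a, ‖∫ x in (-T)..T, g (x + a) * osc lam x‖ ≤ ε * T := by
    intro a
    obtain ⟨t, ht, h1, h2⟩ := hrel a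
    have e1 : ‖∫ x in (-T)..T, g (x + a) * osc lam x‖
        = ‖∫ x in (-T + a)..(T + a), g x * osc lam x‖ := by
      rw [integral_osc_shift, norm_mul, norm_osc, one_mul]
    have e2 : ‖∫ x in (-T)..T, g (x + t) * osc lam x‖
        = ‖∫ x in (-T + t)..(T + t), g x * osc lam x‖ := by
      rw [integral_osc_shift, norm_mul, norm_osc, one_mul]
    have e3 : (∫ x in (-T + a)..(T + a), g x * osc lam x)
        = (∫ x in (-T + t)..(T + t), g x * osc lam x)
          + (∫ x in (-T + a)..(-T + t), g x * osc lam x)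
          - (∫ x in (T + a)..(T + t), g x * osc lam x) := by
      have a1 := intervalIntegral.integral_add_adjacent_intervals
        (hgint' (-T + a) (-T + t)) (hgint' (-T + t) (T + t))
      have a2 := intervalIntegral.integral_add_adjacent_intervals
        (hgint' (-T + a) (T + a)) (hgint' (T + a) (T + t))
      linear_combination a2 - a1
    have e4 : ‖∫ x in (-T)..T, g (x + t) * osc lam x‖ ≤ ε / 4 * T + ε / 4 * (2 * T) := by
      have : (∫ x in (-T)..T, g (x + t) * osc lam x) = (∫ x in (-T)..T, g x * osc lam x)
          - ∫ x in (-T)..T, (g x - g (x + t)) * osc lam x := by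
        rw [← intervalIntegral.integral_sub (hgint' _ _)]
        · congr 1; ext x; ring
        · exact ((hg.1.sub (hg.1.comp (continuous_add_const t))).mul
            (continuous_osc lam)).intervalIntegrable _ _
      rw [this]
      refine (norm_sub_le _ _).trans (add_le_add hT ?_)
      refine (intervalIntegral.norm_integral_le_of_norm_le_const (C := ε / 4) ?_).trans_eq ?_
      · intro x _
        rw [norm_mul, norm_osc, mul_one]
        exact ht x
      · rw [abs_of_nonneg (by linarith)]; ring
    have e5 : ∀ c, ‖∫ x in (c + a)..(c + t), g x * osc lam x‖ ≤ B * l := by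
      intro c
      refine (intervalIntegral.norm_integral_le_of_norm_le_const (fun x _ => hbd x)).trans ?_
      gcongr
      rw [abs_of_nonneg (by linarith)]
      linarith
    rw [e1, e3]
    calc _ ≤ ‖∫ x in (-T + t)..(T + t), g x * osc lam x‖
          + ‖∫ x in (-T + a)..(-T + t), g x * osc lam x‖
          + ‖∫ x in (T + a)..(T + t), g x * osc lam x‖ :=
        (norm_sub_le _ _).trans (add_le_add_left (norm_add_le _ _) _)
      _ ≤ (ε / 4 * T + ε / 4 * (2 * T)) + B * l + B * l := by
        rw [← e2]
        exact add_le_add (add_le_add e4 (e5 _)) (e5 _)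
      _ ≤ ε * T := by nlinarith
  refine ⟨ε / (4 * Real.pi * B * T), by have := Real.pi_pos; positivity, 2 * T, by positivity,
    fun mu hmu a => ?_⟩
  have e1 : ‖∫ x in a..(a + 2 * T), g x * osc mu x‖
      = ‖∫ x in (-T)..T, g (x + (a + T)) * osc mu x‖ := by
    have : (∫ x in a..(a + 2 * T), g x * osc mu x)
        = ∫ x in (-T + (a + T))..(T + (a + T)), g x * osc mu x := by
      congr 1 <;> ring
    rw [this, integral_osc_shift, norm_mul, norm_osc, one_mul]
  have e2 : (∫ x in (-T)..T, g (x + (a + T)) * osc mu x)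
      = (∫ x in (-T)..T, g (x + (a + T)) * osc lam x)
        + ∫ x in (-T)..T, g (x + (a + T)) * (osc mu x - osc lam x) := by
    rw [← intervalIntegral.integral_add (hgint _ _ _ _)]
    · congr 1; ext x; ring
    · exact ((hg.1.comp (continuous_add_const _)).mul
        ((continuous_osc mu).sub (continuous_osc lam))).intervalIntegrable _ _
  rw [e1, e2]
  refine (norm_add_le _ _).trans ?_
  have e3 : ‖∫ x in (-T)..T, g (x + (a + T)) * (osc mu x - osc lam x)‖ ≤ ε / 2 * |T - -T| := by
    refine intervalIntegral.norm_integral_le_of_norm_le_const fun x hx => ?_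
    rw [norm_mul]
    have hx' : |x| ≤ T := by
      rw [uIoc_of_le (by linarith)] at hx
      exact abs_le.2 ⟨hx.1.le, hx.2⟩
    have h3 := norm_osc_sub_osc_le mu lam x
    rw [le_div_iff₀ (by have := Real.pi_pos; positivity)] at hmu
    have hpi := Real.pi_pos
    calc _ ≤ B * (2 * Real.pi * |mu - lam| * T) := by
          refine mul_le_mul (hB _) (h3.trans ?_) (norm_nonneg _) hB0.le
          gcongr
      _ = |mu - lam| * (4 * Real.pi * B * T) / 2 := by ring
      _ ≤ ε / 2 := by linarith
  rw [abs_of_nonneg (by linarith)] at e3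
  have := h1 (a + T)
  linarith

lemma integral_osc_period (lam a : ℝ) (h : lam ≠ 0) :
    ∫ x in a..(a + 1 / |lam|), osc lam x = 0 := by
  have hc : -(2 * (Real.pi : ℂ) * Complex.I * (lam : ℂ)) ≠ 0 := by
    simp [Real.pi_ne_zero, h, Complex.I_ne_zero]
  have e : ∀ x : ℝ, osc lam x = Complex.exp (-(2 * (Real.pi : ℂ) * Complex.I * (lam : ℂ)) * x) := by
    intro x
    rw [osc]
    congr 1
    ring
  simp_rw [e]
  rw [integral_exp_mul_complex hc]
  have : osc lam (a + 1 / |lam|) = osc lam a := by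
    rw [osc_add]
    have : osc lam (1 / |lam|) = 1 := by
      rw [osc, Complex.exp_eq_one_iff]
      rcases lt_or_gt_of_ne h with hl | hl
      · refine ⟨1, ?_⟩
        rw [abs_of_neg hl]
        push_cast
        have : (lam : ℂ) ≠ 0 := by exact_mod_cast h
        field_simp
      · refine ⟨-1, ?_⟩
        rw [abs_of_pos hl]
        push_cast
        have : (lam : ℂ) ≠ 0 := by exact_mod_cast h
        field_simp
    rw [this, mul_one]
  rw [← e, ← e, this, sub_self, zero_div]

lemma windows_large {g : ℝ → ℂ} (hg : APR g) {ε : ℝ} (hε : 0 < ε) :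
    ∃ Λ : ℝ, 0 < Λ ∧ ∀ lam, Λ ≤ |lam| → ∀ a,
      ‖∫ x in a..(a + 1 / |lam|), g x * osc lam x‖ ≤ ε * (1 / |lam|) := by
  obtain ⟨δ, hδ, hu⟩ := hg.unifCont hε
  refine ⟨1 / δ, by positivity, fun lam hlam a => ?_⟩
  have hl : 0 < |lam| := lt_of_lt_of_le (by positivity) hlam
  have hp : 1 / |lam| ≤ δ := by
    rw [div_le_iff₀ hl]
    rw [div_le_iff₀ hδ] at hlam
    linarith
  have hp0 : 0 < 1 / |lam| := by positivity
  have e : (∫ x in a..(a + 1 / |lam|), g x * osc lam x)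
      = ∫ x in a..(a + 1 / |lam|), (g x - g a) * osc lam x := by
    have : (∫ x in a..(a + 1 / |lam|), g a * osc lam x) = 0 := by
      rw [intervalIntegral.integral_const_mul, integral_osc_period _ _ (abs_pos.1 hl), mul_zero]
    rw [← sub_zero (∫ x in a..(a + 1 / |lam|), g x * osc lam x), ← this,
      ← intervalIntegral.integral_sub]
    · congr 1; ext x; ring
    · exact (hg.1.mul (continuous_osc _)).intervalIntegrable _ _
    · exact (continuous_const.mul (continuous_osc _)).intervalIntegrable _ _
  rw [e]
  refine (intervalIntegral.norm_integral_le_of_norm_le_const (C := ε) ?_).trans_eq ?_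
  · intro x hx
    rw [uIoc_of_le (by linarith)] at hx
    rw [norm_mul, norm_osc, mul_one]
    apply hu
    rw [abs_of_nonneg (by linarith [hx.1])]
    linarith [hx.2]
  · rw [add_sub_cancel_left, abs_of_pos hp0]

lemma norm_integral_osc_le {g : ℝ → ℂ} (hg : APR g) (hm : ∀ lam, FreqMeanZero g lam) {ε : ℝ}
    (hε : 0 < ε) : ∃ C ≥ (0 : ℝ), ∀ lam a x, 0 ≤ x →
      ‖∫ u in a..(a + x), g u * osc lam u‖ ≤ ε * x + C := by
  obtain ⟨B, hB0, hB⟩ := hg.bounded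
  obtain ⟨Λ, hΛ, hlarge⟩ := windows_large hg hε
  choose δ hδ p hp hw using fun lam => windows_near hg (hm lam) hε
  obtain ⟨s, -, hs⟩ := (isCompact_Icc (a := -Λ) (b := Λ)).elim_nhds_subcover
    (fun lam => Metric.ball lam (δ lam)) (fun lam _ => Metric.ball_mem_nhds lam (hδ lam))
  have hbd : ∀ lam x, ‖g x * osc lam x‖ ≤ B := fun lam x => by
    rw [norm_mul, norm_osc, mul_one]; exact hB x
  have hcont : ∀ lam, Continuous fun x => g x * osc lam x := fun lam =>
    hg.1.mul (continuous_osc lam)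
  refine ⟨∑ i ∈ s, B * p i + B * (1 / Λ),
    add_nonneg (Finset.sum_nonneg fun i _ => mul_nonneg hB0.le (hp i).le) (by positivity),
    fun lam a x hx => ?_⟩
  have hsum : 0 ≤ ∑ i ∈ s, B * p i :=
    Finset.sum_nonneg fun i _ => mul_nonneg hB0.le (hp i).le
  rcases le_total |lam| Λ with h | h
  · obtain ⟨i, hi, hlam⟩ := mem_iUnion₂.1 (hs (abs_le.1 h))
    have hlam' : |lam - i| ≤ δ i := (Metric.mem_ball.1 hlam).le
    refine (norm_integral_le_of_windows (hcont lam) (hp i) hε.le (hbd lam) (hw i lam hlam') a x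
      hx).trans ?_
    have := Finset.single_le_sum (f := fun i => B * p i)
      (fun j _ => mul_nonneg hB0.le (hp j).le) hi
    have h2 : 0 ≤ B * (1 / Λ) := by positivity
    linarith
  · have hl : 0 < |lam| := hΛ.trans_le h
    refine (norm_integral_le_of_windows (hcont lam) (p := 1 / |lam|) (by positivity) hε.le
      (hbd lam) (hlarge lam h) a x hx).trans ?_
    have : B * (1 / |lam|) ≤ B * (1 / Λ) := by gcongr
    linarith

/-! ### Autocorrelation and the Fourier transform -/

open FourierTransform Convolution in
lemma tendsto_gaussian_fourier {P : ℝ → ℂ} (hP : Integrable P) (hc : ContinuousAt P 0) :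
    Tendsto (fun c : ℝ => ∫ w : ℝ, Complex.exp (-(c : ℂ)⁻¹ * ‖w‖ ^ 2) • 𝓕 P w) atTop
      (𝓝 (P 0)) := by
  refine (Real.tendsto_integral_gaussian_smul' hP hc).congr' ?_
  filter_upwards [Ioi_mem_atTop 0] with c (hc : 0 < c)
  have J : Integrable (fun w : ℝ => Complex.exp (-(c : ℂ)⁻¹ * ‖w‖ ^ 2)) := by
    simpa using GaussianFourier.integrable_cexp_neg_mul_sq_norm_add (V := ℝ)
      (b := (c : ℂ)⁻¹) (by simpa using hc) 0 0
  have h1 : (∫ w : ℝ, Complex.exp (-(c : ℂ)⁻¹ * ‖w‖ ^ 2) • 𝓕 P w)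
      = ∫ w : ℝ, 𝓕 (fun w : ℝ => Complex.exp (-(c : ℂ)⁻¹ * ‖w‖ ^ 2)) w • P w := by
    simpa using! (VectorFourier.integral_fourierIntegral_smul_eq_flip (L := innerₗ ℝ)
      Real.continuous_fourierChar continuous_inner J hP).symm
  rw [h1]
  congr 1
  ext w
  congr 1
  rw [fourier_gaussian_innerProductSpace (by simpa using hc)]
  simp
  ring_nf
  exact Or.inl trivial

/-- The autocorrelation of a function on the line. -/
def autocorr (F : ℝ → ℂ) : ℝ → ℂ := fun t => ∫ x, F x * (starRingEnd ℂ) (F (x - t))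

open FourierTransform Convolution in
lemma autocorr_eq_convolution (F : ℝ → ℂ) :
    autocorr F = F ⋆[ContinuousLinearMap.mul ℂ ℂ] (fun x => (starRingEnd ℂ) (F (-x))) := by
  ext t
  simp [autocorr, convolution]

lemma continuous_reflect_conj {F : ℝ → ℂ} (hF : Continuous F) :
    Continuous fun x => (starRingEnd ℂ) (F (-x)) :=
  Complex.continuous_conj.comp (hF.comp continuous_neg)

lemma hasCompactSupport_reflect_conj {F : ℝ → ℂ} (hs : HasCompactSupport F) :
    HasCompactSupport fun x => (starRingEnd ℂ) (F (-x)) :=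
  (hs.comp_homeomorph (Homeomorph.neg ℝ)).comp_left (g := starRingEnd ℂ) (map_zero _)

lemma continuous_autocorr {F : ℝ → ℂ} (hF : Continuous F) (hs : HasCompactSupport F) :
    Continuous (autocorr F) := by
  rw [autocorr_eq_convolution]
  exact (hasCompactSupport_reflect_conj hs).continuous_convolution_right _
    hF.locallyIntegrable (continuous_reflect_conj hF)

lemma hasCompactSupport_autocorr {F : ℝ → ℂ} (hs : HasCompactSupport F) :
    HasCompactSupport (autocorr F) := by
  rw [autocorr_eq_convolution]
  exact hs.convolution _ (hasCompactSupport_reflect_conj hs)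

open FourierTransform in
lemma fourier_reflect_conj (F : ℝ → ℂ) (ξ : ℝ) :
    𝓕 (fun x => (starRingEnd ℂ) (F (-x))) ξ = (starRingEnd ℂ) (𝓕 F ξ) := by
  have h1 := Real.fourier_real_eq_integral_exp_smul (fun x => (starRingEnd ℂ) (F (-x))) ξ
  have h2 := Real.fourier_real_eq_integral_exp_smul F ξ
  have h3 := integral_neg_eq_self (fun x : ℝ => (starRingEnd ℂ)
    (Complex.exp (((-2 * Real.pi * x * ξ : ℝ) : ℂ) * Complex.I) • F x)) volume
  rw [h1, h2, ← integral_conj, ← h3]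
  congr 1
  ext x
  simp only [smul_eq_mul, map_mul, ← Complex.exp_conj, Complex.conj_ofReal, Complex.conj_I]
  congr 2
  push_cast
  ring

open FourierTransform in
lemma fourier_autocorr {F : ℝ → ℂ} (hF : Integrable F) (ξ : ℝ) :
    𝓕 (autocorr F) ξ = ((‖𝓕 F ξ‖ ^ 2 : ℝ) : ℂ) := by
  have h : Integrable fun x => (starRingEnd ℂ) (F (-x)) :=
    (Complex.conjLIE.integrable_comp_iff).2 hF.comp_neg
  rw [autocorr_eq_convolution, Real.fourier_mul_convolution_eq hF h, fourier_reflect_conj,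
    Complex.mul_conj, Complex.normSq_eq_norm_sq]

lemma autocorr_zero (F : ℝ → ℂ) : autocorr F 0 = ((∫ x, ‖F x‖ ^ 2 : ℝ) : ℂ) := by
  rw [autocorr, ← integral_complex_ofReal]
  congr 1
  ext x
  rw [sub_zero, Complex.mul_conj, Complex.normSq_eq_norm_sq]

open FourierTransform in
lemma tendsto_gaussian_norm_sq_fourier {F : ℝ → ℂ} (hF : Continuous F) (hs : HasCompactSupport F) :
    Tendsto (fun c : ℝ => ∫ w : ℝ, Real.exp (-c⁻¹ * w ^ 2) * ‖𝓕 F w‖ ^ 2) atTop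
      (𝓝 (∫ x, ‖F x‖ ^ 2)) := by
  have h := tendsto_gaussian_fourier
    ((continuous_autocorr hF hs).integrable_of_hasCompactSupport (hasCompactSupport_autocorr hs))
    (continuous_autocorr hF hs).continuousAt
  rw [autocorr_zero] at h
  have h' := (Complex.continuous_re.tendsto _).comp h
  rw [Complex.ofReal_re] at h'
  refine h'.congr fun c => ?_
  rw [Function.comp_apply, ← Complex.ofReal_re (∫ w : ℝ, _), ← integral_complex_ofReal]
  congr 2
  ext w
  rw [fourier_autocorr (hF.integrable_of_hasCompactSupport hs), smul_eq_mul, Real.norm_eq_abs]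
  push_cast
  rw [← Complex.ofReal_pow, sq_abs]
  push_cast
  rfl

open FourierTransform in
lemma integral_norm_sq_autocorr_le {G : ℝ → ℂ} (hG : Continuous G) (hs : HasCompactSupport G)
    {m : ℝ} (hm : ∀ ξ, ‖𝓕 G ξ‖ ≤ m) :
    ∫ t, ‖autocorr G t‖ ^ 2 ≤ m ^ 2 * ∫ x, ‖G x‖ ^ 2 := by
  have hGi : Integrable G := hG.integrable_of_hasCompactSupport hs
  have h1 := tendsto_gaussian_norm_sq_fourier (continuous_autocorr hG hs)
    (hasCompactSupport_autocorr hs)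
  have h2 := (tendsto_gaussian_norm_sq_fourier hG hs).const_mul (m ^ 2)
  refine le_of_tendsto_of_tendsto h1 h2 ?_
  filter_upwards [Ioi_mem_atTop 0] with c (hc : 0 < c)
  rw [← integral_const_mul]
  have hcont : Continuous (𝓕 G) := by
    exact VectorFourier.fourierIntegral_continuous Real.continuous_fourierChar
      (by exact continuous_inner) hGi
  have hgauss : Integrable fun w : ℝ => Real.exp (-c⁻¹ * w ^ 2) :=
    integrable_exp_neg_mul_sq (by positivity)
  have hpow : ∀ n : ℕ, Integrable fun w : ℝ => Real.exp (-c⁻¹ * w ^ 2) * ‖𝓕 G w‖ ^ n := by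
    intro n
    refine hgauss.mul_bdd (c := m ^ n) (by fun_prop) (Eventually.of_forall fun w => ?_)
    rw [norm_pow, norm_norm]
    exact pow_le_pow_left₀ (norm_nonneg _) (hm w) n
  refine integral_mono ?_ ((hpow 2).const_mul _) fun w => ?_
  · refine (hpow 4).congr (Eventually.of_forall fun w => ?_)
    simp only
    rw [fourier_autocorr hGi, Complex.norm_real, Real.norm_eq_abs,
      abs_of_nonneg (by positivity)]
    ring
  · simp only
    rw [fourier_autocorr hGi, Complex.norm_real, Real.norm_eq_abs, abs_of_nonneg (by positivity)]
    have : ‖𝓕 G w‖ ^ 2 ≤ m ^ 2 := pow_le_pow_left₀ (norm_nonneg _) (hm w) 2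
    have h0 : 0 ≤ Real.exp (-c⁻¹ * w ^ 2) * ‖𝓕 G w‖ ^ 2 := by positivity
    nlinarith

/-! ### Uniqueness of almost periodic functions with vanishing means -/

lemma le_integral_of_relDense {φ : ℝ → ℝ} (hc : Continuous φ) (h0 : ∀ x, 0 ≤ φ x)
    {l δ c R : ℝ} (hl : 0 < l) (hδ : 0 < δ) (hR : l + 2 * δ ≤ R)
    (h : ∀ x, ∃ t, x < t ∧ t < x + l ∧ ∀ u, |u - t| ≤ δ → |u| ≤ R → c ≤ φ u) :
    2 * δ * c * (R / (l + 2 * δ)) ≤ ∫ x in (-R)..R, φ x := by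
  set p := l + 2 * δ with hp
  have hp0 : 0 < p := by positivity
  have hi : ∀ a b, IntervalIntegrable φ volume a b := fun a b => hc.intervalIntegrable a b
  have hnn : ∀ a b, a ≤ b → 0 ≤ ∫ x in a..b, φ x := fun a b hab =>
    intervalIntegral.integral_nonneg hab fun x _ => h0 x
  rcases le_or_gt c 0 with hc0 | hc0
  · refine le_trans ?_ (hnn _ _ (by linarith))
    exact mul_nonpos_of_nonpos_of_nonneg
      (mul_nonpos_of_nonneg_of_nonpos (by positivity) hc0) (div_nonneg (by linarith) hp0.le)
  have window : ∀ a, -R ≤ a → a + p ≤ R → 2 * δ * c ≤ ∫ x in a..(a + p), φ x := by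
    intro a ha hb
    obtain ⟨t, h1, h2, h3⟩ := h (a + δ)
    have e1 := intervalIntegral.integral_add_adjacent_intervals (hi a (t - δ)) (hi (t - δ) (t + δ))
    have e2 := intervalIntegral.integral_add_adjacent_intervals (hi a (t + δ)) (hi (t + δ) (a + p))
    have n1 := hnn a (t - δ) (by linarith)
    have n2 := hnn (t + δ) (a + p) (by linarith)
    have m : ∫ _ in (t - δ)..(t + δ), c ≤ ∫ x in (t - δ)..(t + δ), φ x := by
      refine intervalIntegral.integral_mono_on (by linarith) intervalIntegrable_const (hi _ _) ?_
      intro x hx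
      exact h3 x (abs_le.2 ⟨by linarith [hx.1], by linarith [hx.2]⟩)
        (abs_le.2 ⟨by linarith [hx.1], by linarith [hx.2]⟩)
    rw [intervalIntegral.integral_const, smul_eq_mul] at m
    have : (t + δ - (t - δ)) * c = 2 * δ * c := by ring
    linarith
  have key : ∀ n : ℕ, -R + n * p ≤ R → n * (2 * δ * c) ≤ ∫ x in (-R)..(-R + n * p), φ x := by
    intro n
    induction n with
    | zero => intro _; simp
    | succ n ih =>
      intro hn
      push_cast at hn ⊢
      have hn' : (-R + n * p) + p ≤ R := by linarith
      have e : -R + (n + 1) * p = (-R + n * p) + p := by ring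
      have hnp : 0 ≤ n * p := by positivity
      have w := window (-R + n * p) (by linarith) hn'
      have i := ih (by linarith)
      rw [e, ← intervalIntegral.integral_add_adjacent_intervals (hi (-R) (-R + n * p)) (hi _ _)]
      linarith
  set n := ⌊2 * R / p⌋₊ with hn
  have hR0 : 0 ≤ R := by linarith
  have h1 : (n : ℝ) * p ≤ 2 * R := by
    rw [← le_div_iff₀ hp0]
    exact Nat.floor_le (by positivity)
  have h2 : 2 * R / p < n + 1 := Nat.lt_floor_add_one _
  have h3 : 1 ≤ R / p := by rwa [le_div_iff₀ hp0, one_mul]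
  have h4 : R / p ≤ n := by
    have : 2 * R / p = 2 * (R / p) := by ring
    linarith
  have k := key n (by linarith)
  have e := intervalIntegral.integral_add_adjacent_intervals (hi (-R) (-R + n * p)) (hi _ R)
  have n1 := hnn (-R + n * p) R (by linarith)
  have : 2 * δ * c * (R / p) ≤ n * (2 * δ * c) := by
    rw [mul_comm]
    gcongr
  linarith

/-- The parabolic window on `[-T, T]`. -/
def bump (T x : ℝ) : ℝ := max 0 (1 - (x / T) ^ 2)

lemma continuous_bump (T : ℝ) : Continuous (bump T) := by
  unfold bump
  fun_prop

lemma bump_nonneg (T x : ℝ) : 0 ≤ bump T x := le_max_left _ _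

lemma bump_le_one (T x : ℝ) : bump T x ≤ 1 :=
  max_le zero_le_one (by linarith [sq_nonneg (x / T)])

lemma bump_of_abs_le {T x : ℝ} (hT : 0 < T) (hx : |x| ≤ T) : bump T x = 1 - (x / T) ^ 2 := by
  refine max_eq_right ?_
  have : |x / T| ≤ 1 := by rwa [abs_div, abs_of_pos hT, div_le_one hT]
  have := (sq_le_one_iff_abs_le_one (x / T)).2 this
  linarith

lemma bump_of_le_abs {T x : ℝ} (hT : 0 < T) (hx : T ≤ |x|) : bump T x = 0 := by
  refine max_eq_left ?_
  have : 1 ≤ |x / T| := by rwa [abs_div, abs_of_pos hT, one_le_div hT]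
  have := (one_le_sq_iff_one_le_abs (x / T)).2 this
  linarith

lemma bump_ge_of_abs_le {T x : ℝ} (hT : 0 < T) (hx : |x| ≤ T / 2) : 3 / 4 ≤ bump T x := by
  rw [bump_of_abs_le hT (by linarith)]
  have : |x / T| ≤ 1 / 2 := by
    rw [abs_div, abs_of_pos hT, div_le_iff₀ hT]
    linarith
  have := sq_le_sq' (abs_le.1 this).1 (abs_le.1 this).2
  linarith

lemma hasCompactSupport_mul_bump (g : ℝ → ℂ) {T : ℝ} (hT : 0 < T) :
    HasCompactSupport fun x => g x * (bump T x : ℂ) := by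
  refine HasCompactSupport.of_support_subset_isCompact (isCompact_Icc (a := -T) (b := T)) ?_
  intro x hx
  by_contra hxT
  refine hx ?_
  have : T ≤ |x| := by
    by_contra! h
    exact hxT ⟨(abs_lt.1 h).1.le, (abs_lt.1 h).2.le⟩
  simp [bump_of_le_abs hT this]

lemma integral_eq_of_eq_zero_outside {E : Type*} [NormedAddCommGroup E] [NormedSpace ℝ E]
    {φ : ℝ → E} {T : ℝ} (h : ∀ x, T ≤ |x| → φ x = 0) :
    ∫ x, φ x = ∫ x in (-T)..T, φ x := by
  symm
  refine intervalIntegral.integral_eq_integral_of_support_subset fun x hx => ?_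
  by_contra hxT
  refine hx (h x ?_)
  by_contra! h'
  exact hxT ⟨(abs_lt.1 h').1, (abs_lt.1 h').2.le⟩

open FourierTransform in
lemma norm_fourier_mul_bump_le {g : ℝ → ℂ} (hg : Continuous g) {ε C : ℝ} (hε : 0 ≤ ε)
    (h : ∀ lam a x, 0 ≤ x → ‖∫ u in a..(a + x), g u * osc lam u‖ ≤ ε * x + C) {T : ℝ}
    (hT : 0 < T) (ξ : ℝ) : ‖𝓕 (fun x => g x * (bump T x : ℂ)) ξ‖ ≤ 4 * (ε * T + C) := by
  have e1 : 𝓕 (fun x => g x * (bump T x : ℂ)) ξ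
      = ∫ x in (-T)..T, (1 - ((x : ℂ) / T) ^ 2) * (g x * osc ξ x) := by
    rw [Real.fourier_real_eq_integral_exp_smul, integral_eq_of_eq_zero_outside (T := T)]
    · refine intervalIntegral.integral_congr fun x hx => ?_
      rw [uIcc_of_le (by linarith)] at hx
      simp only [smul_eq_mul]
      rw [bump_of_abs_le hT (abs_le.2 hx)]
      have : Complex.exp (((-2 * Real.pi * x * ξ : ℝ) : ℂ) * Complex.I) = osc ξ x := by
        rw [osc]
        congr 1
        push_cast
        ring
      rw [this]
      push_cast
      ring
    · intro x hx
      simp [bump_of_le_abs hT hx]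
  have hcont : Continuous fun x => g x * osc ξ x := hg.mul (continuous_osc ξ)
  set Φ : ℝ → ℂ := fun x => ∫ u in (0 : ℝ)..x, g u * osc ξ u with hΦ
  have hΦd : ∀ x, HasDerivAt Φ (g x * osc ξ x) x := fun x =>
    intervalIntegral.integral_hasDerivAt_right (hcont.intervalIntegrable _ _)
      (hcont.stronglyMeasurableAtFilter _ _) hcont.continuousAt
  have hud : ∀ x : ℝ, HasDerivAt (fun x : ℝ => (1 : ℂ) - ((x : ℂ) / T) ^ 2)
      (-(2 * ((x : ℂ) / T) * (1 / T)) : ℂ) x := by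
    intro x
    have h1 : HasDerivAt (fun x : ℝ => (x : ℂ)) 1 x := Complex.ofRealCLM.hasDerivAt
    have h2 := h1.div_const (T : ℂ)
    have h3 : HasDerivAt (fun x : ℝ => (1 : ℂ) - ((x : ℂ) / T) * ((x : ℂ) / T))
      (-(1 / (T : ℂ) * ((x : ℂ) / T) + (x : ℂ) / T * (1 / (T : ℂ)))) x := (h2.mul h2).const_sub 1
    simp only [pow_two]
    exact h3.congr_deriv (by ring)
  have hΦc : Continuous Φ := continuous_iff_continuousAt.2 fun x => (hΦd x).continuousAt
  have e2 := intervalIntegral.integral_mul_deriv_eq_deriv_mul (a := -T) (b := T)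
    (fun x _ => hud x) (fun x _ => hΦd x)
    ((by fun_prop : Continuous fun x : ℝ => -(2 * ((x : ℂ) / T) * (1 / T))).intervalIntegrable _ _)
    (hcont.intervalIntegrable _ _)
  have hT' : (T : ℂ) ≠ 0 := by exact_mod_cast hT.ne'
  rw [e1, e2]
  have z1 : (1 : ℂ) - ((T : ℂ) / T) ^ 2 = 0 := by rw [div_self hT']; ring
  have z2 : (1 : ℂ) - (((-T : ℝ) : ℂ) / T) ^ 2 = 0 := by
    push_cast
    rw [neg_div, div_self hT']
    ring
  rw [z1, z2, zero_mul, zero_mul, sub_self, zero_sub, norm_neg]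
  refine (intervalIntegral.norm_integral_le_of_norm_le_const (C := 2 / T * (ε * T + C))
    fun x hx => ?_).trans_eq ?_
  · rw [uIoc_of_le (by linarith)] at hx
    have hx' : |x| ≤ T := abs_le.2 ⟨hx.1.le, hx.2⟩
    have hb : ‖Φ x‖ ≤ ε * |x| + C := by
      rcases le_total 0 x with h0 | h0
      · have := h ξ 0 x h0
        rw [zero_add] at this
        rwa [abs_of_nonneg h0]
      · have := h ξ x (-x) (by linarith)
        rw [add_neg_cancel, intervalIntegral.integral_symm, norm_neg] at this
        rwa [abs_of_nonpos h0]
    rw [norm_mul]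
    refine mul_le_mul ?_ (hb.trans (by gcongr)) (norm_nonneg _) (by positivity)
    rw [norm_neg, norm_mul, norm_mul, norm_div, norm_div, Complex.norm_real, Complex.norm_real,
      Complex.norm_ofNat, norm_one, Real.norm_eq_abs, Real.norm_eq_abs, abs_of_pos hT]
    have : |x| / T ≤ 1 := by rwa [div_le_one hT]
    calc 2 * (|x| / T) * (1 / T) ≤ 2 * 1 * (1 / T) := by gcongr
      _ = 2 / T := by ring
  · rw [abs_of_nonneg (by linarith)]
    field_simp
    ring

lemma continuous_mul_bump {g : ℝ → ℂ} (hg : Continuous g) (T : ℝ) :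
    Continuous fun x => g x * (bump T x : ℂ) :=
  hg.mul (Complex.continuous_ofReal.comp (continuous_bump T))

lemma norm_autocorr_mul_bump_ge {g : ℝ → ℂ} (hg : Continuous g) {B ε t T : ℝ}
    (hB : ∀ x, ‖g x‖ ≤ B) (hT : 0 < T) (ht : |t| ≤ T / 4) (h : ∀ x, ‖g x - g (x - t)‖ ≤ ε) :
    1 / 2 * (∫ x in (-(T / 4))..(T / 4), ‖g x‖ ^ 2) - 2 * T * (ε * B)
      ≤ ‖autocorr (fun x => g x * (bump T x : ℂ)) t‖ := by
  have hB0 : 0 ≤ B := (norm_nonneg _).trans (hB 0)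
  have hε : 0 ≤ ε := (norm_nonneg _).trans (h 0)
  have hw : Continuous fun x => bump T x * bump T (x - t) :=
    (continuous_bump T).mul ((continuous_bump T).comp (continuous_id.sub continuous_const))
  have hw0 : ∀ x, 0 ≤ bump T x * bump T (x - t) := fun x =>
    mul_nonneg (bump_nonneg _ _) (bump_nonneg _ _)
  have hw1 : ∀ x, bump T x * bump T (x - t) ≤ 1 := fun x =>
    mul_le_one₀ (bump_le_one _ _) (bump_nonneg _ _) (bump_le_one _ _)
  have hF : Continuous fun x => (g x * (bump T x : ℂ)) *
      (starRingEnd ℂ) (g (x - t) * (bump T (x - t) : ℂ)) :=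
    (continuous_mul_bump hg T).mul (Complex.continuous_conj.comp
      ((continuous_mul_bump hg T).comp (continuous_id.sub continuous_const)))
  have e : autocorr (fun x => g x * (bump T x : ℂ)) t
      = ∫ x in (-T)..T, (g x * (bump T x : ℂ)) *
        (starRingEnd ℂ) (g (x - t) * (bump T (x - t) : ℂ)) := by
    rw [autocorr]
    refine integral_eq_of_eq_zero_outside fun x hx => ?_
    simp [bump_of_le_abs hT hx]
  have hn : Continuous fun x => ‖g x‖ ^ 2 := by fun_prop
  have hlow : ∀ x, ‖g x‖ ^ 2 * (bump T x * bump T (x - t)) - ε * B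
      ≤ ((g x * (bump T x : ℂ)) * (starRingEnd ℂ) (g (x - t) * (bump T (x - t) : ℂ))).re := by
    intro x
    have e1 : (g x * (bump T x : ℂ)) * (starRingEnd ℂ) (g (x - t) * (bump T (x - t) : ℂ))
        = ((‖g x‖ ^ 2 * (bump T x * bump T (x - t)) : ℝ) : ℂ)
          - g x * (starRingEnd ℂ) (g x - g (x - t)) * ((bump T x * bump T (x - t) : ℝ) : ℂ) := by
      rw [map_mul, map_sub, Complex.conj_ofReal, mul_sub, Complex.mul_conj,
        Complex.normSq_eq_norm_sq]
      push_cast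
      ring
    rw [e1, Complex.sub_re, Complex.ofReal_re]
    have : (g x * (starRingEnd ℂ) (g x - g (x - t)) * ((bump T x * bump T (x - t) : ℝ) : ℂ)).re
        ≤ ε * B := by
      refine (Complex.re_le_norm _).trans ?_
      rw [norm_mul, norm_mul, RCLike.norm_conj, Complex.norm_real, Real.norm_eq_abs,
        abs_of_nonneg (hw0 x)]
      calc ‖g x‖ * ‖g x - g (x - t)‖ * (bump T x * bump T (x - t)) ≤ B * ε * 1 := by
            gcongr
            · exact hw0 x
            · exact hB x
            · exact h x
            · exact hw1 x
        _ = ε * B := by ring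
    linarith
  have hc1 : Continuous fun x => ‖g x‖ ^ 2 * (bump T x * bump T (x - t)) := hn.mul hw
  have s1 : ∫ x in (-T)..T, (‖g x‖ ^ 2 * (bump T x * bump T (x - t)) - ε * B)
      ≤ ∫ x in (-T)..T, ((g x * (bump T x : ℂ)) *
        (starRingEnd ℂ) (g (x - t) * (bump T (x - t) : ℂ))).re := by
    refine intervalIntegral.integral_mono_on (by linarith)
      ((hc1.sub continuous_const).intervalIntegrable _ _)
      ((Complex.continuous_re.comp hF).intervalIntegrable _ _) fun x _ => hlow x
  have s2 : ∫ x in (-T)..T, ((g x * (bump T x : ℂ)) *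
        (starRingEnd ℂ) (g (x - t) * (bump T (x - t) : ℂ))).re
      = (∫ x in (-T)..T, (g x * (bump T x : ℂ)) *
        (starRingEnd ℂ) (g (x - t) * (bump T (x - t) : ℂ))).re :=
    Complex.reCLM.intervalIntegral_comp_comm (hF.intervalIntegrable _ _)
  have s3 : ∫ x in (-T)..T, (‖g x‖ ^ 2 * (bump T x * bump T (x - t)) - ε * B)
      = (∫ x in (-T)..T, ‖g x‖ ^ 2 * (bump T x * bump T (x - t))) - 2 * T * (ε * B) := by
    rw [intervalIntegral.integral_sub (hc1.intervalIntegrable _ _) intervalIntegrable_const,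
      intervalIntegral.integral_const, smul_eq_mul]
    ring
  have s4 : ∫ x in (-(T / 4))..(T / 4), ‖g x‖ ^ 2 * (bump T x * bump T (x - t))
      ≤ ∫ x in (-T)..T, ‖g x‖ ^ 2 * (bump T x * bump T (x - t)) :=
    intervalIntegral.integral_mono_interval (by linarith) (by linarith) (by linarith)
      (ae_of_all _ fun x => mul_nonneg (by positivity) (hw0 x)) (hc1.intervalIntegrable _ _)
  have s5 : ∫ x in (-(T / 4))..(T / 4), 1 / 2 * ‖g x‖ ^ 2
      ≤ ∫ x in (-(T / 4))..(T / 4), ‖g x‖ ^ 2 * (bump T x * bump T (x - t)) := by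
    refine intervalIntegral.integral_mono_on (by linarith)
      ((continuous_const.mul hn).intervalIntegrable _ _) (hc1.intervalIntegrable _ _) ?_
    intro x hx
    have hx' : |x| ≤ T / 4 := abs_le.2 hx
    have b1 : 3 / 4 ≤ bump T x := bump_ge_of_abs_le hT (by linarith)
    have b2 : 3 / 4 ≤ bump T (x - t) := by
      refine bump_ge_of_abs_le hT ?_
      have := abs_sub x t
      linarith
    have : 1 / 2 ≤ bump T x * bump T (x - t) := by nlinarith
    nlinarith [sq_nonneg ‖g x‖]
  rw [intervalIntegral.integral_const_mul] at s5
  have := Complex.re_le_norm (autocorr (fun x => g x * (bump T x : ℂ)) t)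
  rw [e] at this ⊢
  linarith

theorem APR.eq_zero {g : ℝ → ℂ} (hg : APR g) (hm : ∀ lam, FreqMeanZero g lam) (x₀ : ℝ) :
    g x₀ = 0 := by
  by_contra hx₀
  set η := ‖g x₀‖ with hη
  have hη0 : 0 < η := norm_pos_iff.2 hx₀
  obtain ⟨B, hB0, hB⟩ := hg.bounded
  obtain ⟨δ₀, hδ₀, hu₀⟩ := hg.unifCont (ε := η / 4) (by positivity)
  obtain ⟨l₀, hl₀, hr₀⟩ := hg.2 (η / 4) (by positivity)
  have step1 : ∀ T, l₀ + 2 * δ₀ ≤ T / 4 →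
      2 * δ₀ * (η ^ 2 / 4) * (T / 4 / (l₀ + 2 * δ₀)) ≤ ∫ x in (-(T / 4))..(T / 4), ‖g x‖ ^ 2 := by
    intro T hT
    refine le_integral_of_relDense (by have := hg.1; fun_prop) (fun x => by positivity) hl₀ hδ₀ hT
      fun x => ?_
    obtain ⟨t, ht, h1, h2⟩ := hr₀ (x - x₀)
    refine ⟨x₀ + t, by linarith, by linarith, fun u hu _ => ?_⟩
    have n1 := ht x₀
    have n2 := hu₀ u (x₀ + t) hu
    have n3 : η / 2 ≤ ‖g u‖ := by
      have : g x₀ = g u + (g x₀ - g (x₀ + t)) - (g u - g (x₀ + t)) := by ring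
      have h3 : η ≤ ‖g u‖ + ‖g x₀ - g (x₀ + t)‖ + ‖g u - g (x₀ + t)‖ := by
        rw [hη]
        nth_rewrite 1 [this]
        exact (norm_sub_le _ _).trans (by gcongr; exact norm_add_le _ _)
      linarith
    calc η ^ 2 / 4 = (η / 2) ^ 2 := by ring
      _ ≤ ‖g u‖ ^ 2 := by gcongr
  set c₁ := 2 * δ₀ * (η ^ 2 / 4) * (1 / 4 / (l₀ + 2 * δ₀)) with hc₁
  have hc₁0 : 0 < c₁ := by positivity
  set ε₁ := c₁ / (16 * B) with hε₁
  have hε₁0 : 0 < ε₁ := by positivity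
  obtain ⟨δ₁, hδ₁, hu₁⟩ := hg.unifCont hε₁0
  obtain ⟨l₁, hl₁, hr₁⟩ := hg.2 ε₁ hε₁0
  set κ := 2 * δ₁ * (c₁ / 4) ^ 2 * (1 / 4 / (l₁ + 2 * δ₁)) with hκ
  have hκ0 : 0 < κ := by positivity
  -- small constant for the Fourier bound
  set ε := Real.sqrt (κ / (256 * B ^ 2)) with hε
  have hε0 : 0 < ε := by positivity
  have hεsq : ε ^ 2 = κ / (256 * B ^ 2) := Real.sq_sqrt (by positivity)
  obtain ⟨C, hC, hFour⟩ := norm_integral_osc_le hg hm hε0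
  set T := 4 * (l₀ + 2 * δ₀) + 4 * (l₁ + 2 * δ₁) + C / ε with hT
  have hCε : 0 ≤ C / ε := by positivity
  have hT0 : 0 < T := by positivity
  have hTl₀ : l₀ + 2 * δ₀ ≤ T / 4 := by rw [hT]; linarith
  have hTl₁ : l₁ + 2 * δ₁ ≤ T / 4 := by rw [hT]; linarith
  have hTC : C ≤ ε * T := by
    rw [mul_comm, ← div_le_iff₀ hε0, hT]
    linarith
  set G : ℝ → ℂ := fun x => g x * (bump T x : ℂ) with hG
  have hGc : Continuous G := continuous_mul_bump hg.1 T
  have hGs : HasCompactSupport G := hasCompactSupport_mul_bump g hT0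
  have upper := integral_norm_sq_autocorr_le hGc hGs
    (norm_fourier_mul_bump_le hg.1 hε0.le hFour hT0)
  have hGn : ∫ x, ‖G x‖ ^ 2 ≤ B ^ 2 * (2 * T) := by
    rw [integral_eq_of_eq_zero_outside (T := T)]
    · calc ∫ x in (-T)..T, ‖G x‖ ^ 2 ≤ ∫ x in (-T)..T, B ^ 2 := by
            refine intervalIntegral.integral_mono_on (by linarith)
              ((by fun_prop : Continuous fun x => ‖G x‖ ^ 2).intervalIntegrable _ _)
              intervalIntegrable_const fun x _ => ?_
            have : ‖G x‖ ≤ B := by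
              rw [hG, norm_mul, Complex.norm_real, Real.norm_eq_abs, abs_of_nonneg (bump_nonneg _ _)]
              exact (mul_le_of_le_one_right (norm_nonneg _) (bump_le_one _ _)).trans (hB x)
            gcongr
        _ = B ^ 2 * (2 * T) := by
            rw [intervalIntegral.integral_const, smul_eq_mul]
            ring
    · intro x hx
      simp [hG, bump_of_le_abs hT0 hx]
  have hac := continuous_autocorr hGc hGs
  have lower1 : 2 * δ₁ * (c₁ / 4 * T) ^ 2 * (T / 4 / (l₁ + 2 * δ₁))
      ≤ ∫ t in (-(T / 4))..(T / 4), ‖autocorr G t‖ ^ 2 := by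
    refine le_integral_of_relDense (by fun_prop) (fun x => by positivity) hl₁ hδ₁ hTl₁
      fun x => ?_
    obtain ⟨s, hs, h1, h2⟩ := hr₁ x
    refine ⟨s, h1, h2, fun t ht htT => ?_⟩
    have close : ∀ x, ‖g x - g (x - t)‖ ≤ 2 * ε₁ := by
      intro x
      have n1 := hs (x - t)
      have n2 := hu₁ x (x - t + s) (by rwa [show x - (x - t + s) = t - s by ring])
      have e : g x - g (x - t) = (g x - g (x - t + s)) - (g (x - t) - g (x - t + s)) := by ring
      rw [e]
      exact (norm_sub_le _ _).trans (by linarith)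
    have n := norm_autocorr_mul_bump_ge hg.1 hB hT0 htT close
    have s1 := step1 T hTl₀
    have e1 : 2 * δ₀ * (η ^ 2 / 4) * (T / 4 / (l₀ + 2 * δ₀)) = c₁ * T := by rw [hc₁]; ring
    have e2 : 2 * T * (2 * ε₁ * B) = c₁ / 4 * T := by
      rw [hε₁]
      field_simp
      norm_num
    rw [e1] at s1
    rw [e2] at n
    have : c₁ / 4 * T ≤ ‖autocorr G t‖ := by linarith
    gcongr
  have lower2 : ∫ t in (-(T / 4))..(T / 4), ‖autocorr G t‖ ^ 2 ≤ ∫ t, ‖autocorr G t‖ ^ 2 := by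
    rw [intervalIntegral.integral_of_le (by linarith)]
    refine setIntegral_le_integral ?_ (ae_of_all _ fun x => by positivity)
    refine Continuous.integrable_of_hasCompactSupport (by fun_prop) ?_
    exact (hasCompactSupport_autocorr hGs).comp_left (g := fun z => ‖z‖ ^ 2) (by simp)
  have e3 : 2 * δ₁ * (c₁ / 4 * T) ^ 2 * (T / 4 / (l₁ + 2 * δ₁)) = κ * T ^ 3 := by rw [hκ]; ring
  have fin : (4 * (ε * T + C)) ^ 2 * ∫ x, ‖G x‖ ^ 2 ≤ κ / 2 * T ^ 3 := by
    calc (4 * (ε * T + C)) ^ 2 * ∫ x, ‖G x‖ ^ 2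
        ≤ (4 * (ε * T + ε * T)) ^ 2 * (B ^ 2 * (2 * T)) := by
          gcongr
      _ = ε ^ 2 * (128 * B ^ 2) * T ^ 3 := by ring
      _ = κ / 2 * T ^ 3 := by
          rw [hεsq]
          field_simp
          norm_num
  have : 0 < κ * T ^ 3 := by positivity
  linarith

/-! ### Almost periodic functions on the half-plane -/

lemma APH.bounded_strip {f : ℂ → ℂ} (hf : APH f) {a b : ℝ} (ha : 0 < a) (hab : a ≤ b) :
    ∃ M ≥ (0 : ℝ), ∀ z : ℂ, a ≤ z.im → z.im ≤ b → ‖f z‖ ≤ M := by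
  obtain ⟨τ, ⟨l, hl, hτ⟩, h⟩ := hf.2 (a / 2) (b + 1) 1 (by positivity) (by linarith) one_pos
  have hK : IsCompact (Icc (0 : ℝ) l ×ℂ Icc a b) := isCompact_Icc.reProdIm isCompact_Icc
  have hsub : Icc (0 : ℝ) l ×ℂ Icc a b ⊆ UHP := fun z hz => ha.trans_le hz.2.1
  obtain ⟨C, hC⟩ := hK.exists_bound_of_continuousOn (hf.1.continuousOn.mono hsub)
  refine ⟨max C 0 + 1, by positivity, fun z h1 h2 => ?_⟩
  obtain ⟨t, htτ, ht1, ht2⟩ := hτ (-z.re)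
  have n1 := h t htτ z (by linarith) (by linarith)
  have n2 := hC (z + t) ⟨by simp; constructor <;> linarith, by simp [h1, h2]⟩
  have : f z = (f z - f (z + t)) + f (z + t) := by ring
  rw [this]
  refine (norm_add_le _ _).trans ?_
  have := le_max_left C 0
  linarith

lemma APH.continuous_slice {f : ℂ → ℂ} (hf : APH f) {y : ℝ} (hy : 0 < y) :
    Continuous fun x : ℝ => f ((x : ℂ) + (y : ℂ) * Complex.I) := by
  refine hf.1.continuousOn.comp_continuous (by fun_prop) fun x => ?_
  simpa [UHP] using hy

lemma APH.apr {f : ℂ → ℂ} (hf : APH f) {y : ℝ} (hy : 0 < y) :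
    APR fun x : ℝ => f ((x : ℂ) + (y : ℂ) * Complex.I) := by
  refine ⟨hf.continuous_slice hy, fun ε hε => ?_⟩
  obtain ⟨τ, ⟨l, hl, hτ⟩, h⟩ := hf.2 (y / 2) (y + 1) ε (by positivity) (by linarith) hε
  refine ⟨l, hl, fun x => ?_⟩
  obtain ⟨t, ht, h1, h2⟩ := hτ x
  refine ⟨t, fun u => ?_, h1, h2⟩
  have := h t ht ((u : ℂ) + (y : ℂ) * Complex.I) (by simp; linarith) (by simp)
  convert this using 4
  push_cast
  ring

/-- The truncated means whose limit is `ℰf(λ)`, taken at height `y`. -/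
def meanAt (f : ℂ → ℂ) (y lam T : ℝ) : ℂ :=
  (1 / (2 * (T : ℂ))) * ∫ x in (-T)..T, f ((x : ℂ) + (y : ℂ) * Complex.I) *
    Complex.exp (-(2 * (Real.pi : ℂ) * Complex.I * (lam : ℂ) * ((x : ℂ) + (y : ℂ) * Complex.I)))

lemma hasMeanAt_iff (f : ℂ → ℂ) (y lam : ℝ) (c : ℂ) :
    HasMeanAt f y lam c ↔ Tendsto (meanAt f y lam) atTop (𝓝 c) := Iff.rfl

lemma exp_eq_osc (lam x y : ℝ) :
    Complex.exp (-(2 * (Real.pi : ℂ) * Complex.I * (lam : ℂ) * ((x : ℂ) + (y : ℂ) * Complex.I)))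
      = osc lam x * (Real.exp (2 * Real.pi * lam * y) : ℂ) := by
  rw [osc, Complex.ofReal_exp, ← Complex.exp_add]
  congr 1
  push_cast
  linear_combination (-2 * (Real.pi : ℂ) * lam * y) * Complex.I_sq

lemma meanAt_eq_osc (f : ℂ → ℂ) (y lam T : ℝ) :
    meanAt f y lam T = (Real.exp (2 * Real.pi * lam * y) : ℂ) * ((1 / (2 * (T : ℂ))) *
      ∫ x in (-T)..T, f ((x : ℂ) + (y : ℂ) * Complex.I) * osc lam x) := by
  simp only [meanAt, exp_eq_osc, ← mul_assoc, intervalIntegral.integral_mul_const]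
  ring

lemma norm_exp_mean (lam : ℝ) (z : ℂ) :
    ‖Complex.exp (-(2 * (Real.pi : ℂ) * Complex.I * (lam : ℂ) * z))‖
      = Real.exp (2 * Real.pi * lam * z.im) := by
  rw [Complex.norm_exp]
  congr 1
  simp

lemma tendsto_const_div_atTop (K : ℝ) : Tendsto (fun T : ℝ => K / T) atTop (𝓝 0) :=
  tendsto_const_nhds.div_atTop tendsto_id

lemma tendsto_meanAt_sub {f : ℂ → ℂ} {a b M : ℝ} (hab : a ≤ b)
    (hd : DifferentiableOn ℂ f {z | a ≤ z.im ∧ z.im ≤ b})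
    (hM : ∀ z : ℂ, a ≤ z.im → z.im ≤ b → ‖f z‖ ≤ M) (lam : ℝ) :
    Tendsto (fun T => meanAt f b lam T - meanAt f a lam T) atTop (𝓝 0) := by
  have hM0 : 0 ≤ M := (norm_nonneg _).trans (hM ((a : ℂ) * Complex.I) (by simp) (by simpa))
  set e : ℂ → ℂ := fun z => Complex.exp (-(2 * (Real.pi : ℂ) * Complex.I * (lam : ℂ) * z))
    with he
  set E := Real.exp (2 * Real.pi * |lam| * max |a| |b|) with hE
  have hFb : ∀ z : ℂ, a ≤ z.im → z.im ≤ b → ‖f z * e z‖ ≤ M * E := by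
    intro z h1 h2
    rw [norm_mul, he]
    simp only
    rw [norm_exp_mean]
    have hz : |z.im| ≤ max |a| |b| := abs_le_max_abs_abs h1 h2
    have : lam * z.im ≤ |lam| * max |a| |b| :=
      (le_abs_self _).trans (by rw [abs_mul]; gcongr)
    refine mul_le_mul (hM z h1 h2) (Real.exp_le_exp.2 ?_) (Real.exp_pos _).le hM0
    have := mul_le_mul_of_nonneg_left this (by positivity : 0 ≤ 2 * Real.pi)
    linarith
  have hFd : DifferentiableOn ℂ (fun z => f z * e z) {z | a ≤ z.im ∧ z.im ≤ b} :=
    hd.mul (by rw [he]; fun_prop)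
  refine squeeze_zero_norm' ?_ (tendsto_const_div_atTop (M * E * (b - a)))
  filter_upwards [Ioi_mem_atTop 0] with T (hT : 0 < T)
  have rect := Complex.integral_boundary_rect_eq_zero_of_differentiableOn (fun z => f z * e z)
    (⟨-T, a⟩ : ℂ) (⟨T, b⟩ : ℂ) (hFd.mono fun z hz => by
      have := hz.2
      simp only [mem_preimage, uIcc_of_le hab] at this
      exact this)
  simp only [smul_eq_mul] at rect
  have side : ∀ r : ℝ, ‖∫ y in a..b, f ((r : ℂ) + y * Complex.I) * e ((r : ℂ) + y * Complex.I)‖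
      ≤ M * E * (b - a) := by
    intro r
    refine (intervalIntegral.norm_integral_le_of_norm_le_const (C := M * E) fun y hy => ?_).trans_eq
      (by rw [abs_of_nonneg (by linarith)])
    rw [uIoc_of_le hab] at hy
    exact hFb _ (by simpa using hy.1.le) (by simpa using hy.2)
  have e1 : meanAt f b lam T - meanAt f a lam T = (1 / (2 * (T : ℂ))) *
      (Complex.I * (∫ y in a..b, f ((T : ℂ) + y * Complex.I) * e ((T : ℂ) + y * Complex.I))
      - Complex.I * ∫ y in a..b, f (((-T : ℝ) : ℂ) + y * Complex.I) *
          e (((-T : ℝ) : ℂ) + y * Complex.I)) := by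
    rw [meanAt, meanAt, ← mul_sub]
    congr 1
    linear_combination -rect
  rw [e1, norm_mul]
  have n1 := side T
  have n2 := side (-T)
  have : ‖1 / (2 * (T : ℂ))‖ = 1 / (2 * T) := by
    rw [norm_div, norm_mul, Complex.norm_real, Real.norm_eq_abs, abs_of_pos hT]
    simp
  rw [this]
  refine (mul_le_mul_of_nonneg_left (norm_sub_le _ _) (by positivity)).trans ?_
  rw [norm_mul, norm_mul, Complex.norm_I, one_mul, one_mul]
  calc 1 / (2 * T) * _ ≤ 1 / (2 * T) * (M * E * (b - a) + M * E * (b - a)) := by gcongr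
    _ = M * E * (b - a) / T := by field_simp; ring

lemma freqMeanZero_of_tendsto {g : ℝ → ℂ} {lam : ℝ} {U : Filter ℝ} [U.NeBot] (hU : U ≤ atTop)
    (h : Tendsto (fun T : ℝ => (1 / (2 * (T : ℂ))) * ∫ x in (-T)..T, g x * osc lam x) U
      (𝓝 0)) : FreqMeanZero g lam := by
  intro ε hε
  refine Frequently.filter_mono (Eventually.frequently ?_) hU
  filter_upwards [hU (Ioi_mem_atTop 0), (Metric.tendsto_nhds.1 h) (ε / 2) (by positivity)]
    with T (hT : 0 < T) h
  rw [dist_zero_right, norm_mul] at h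
  have : ‖1 / (2 * (T : ℂ))‖ = 1 / (2 * T) := by
    rw [norm_div, norm_mul, Complex.norm_real, Real.norm_eq_abs, abs_of_pos hT]
    simp
  rw [this, one_div, inv_mul_lt_iff₀ (by positivity)] at h
  linarith

/-! ### Smoothing by a rescaled integrable kernel -/

/-- The average `∫ g(x - sv) k(v) dv`. -/
def smooth (g k : ℝ → ℂ) (s x : ℝ) : ℂ := ∫ v, g (x - s * v) * k v

section smooth

variable {g k : ℝ → ℂ} {B : ℝ}

lemma integrable_smooth (hg : Continuous g) (hk : Integrable k) (hB : ∀ x, ‖g x‖ ≤ B) (s x : ℝ) :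
    Integrable fun v => g (x - s * v) * k v :=
  hk.bdd_mul (by fun_prop) (ae_of_all _ fun v => hB _)

lemma continuous_smooth (hg : Continuous g) (hk : Integrable k) (hB : ∀ x, ‖g x‖ ≤ B) (s : ℝ) :
    Continuous (smooth g k s) := by
  refine continuous_of_dominated (bound := fun v => B * ‖k v‖)
    (fun x => (integrable_smooth hg hk hB s x).aestronglyMeasurable)
    (fun x => ae_of_all _ fun v => ?_) (hk.norm.const_mul B) (ae_of_all _ fun v => by fun_prop)
  rw [norm_mul]
  gcongr
  exact hB _

lemma norm_smooth_le (hB : ∀ x, ‖g x‖ ≤ B) (hk : Integrable k) (s x : ℝ) :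
    ‖smooth g k s x‖ ≤ B * ∫ v, ‖k v‖ := by
  rw [smooth, ← integral_const_mul]
  refine norm_integral_le_of_norm_le (hk.norm.const_mul B) (ae_of_all _ fun v => ?_)
  rw [norm_mul]
  gcongr
  exact hB _

lemma smooth_sub_smooth (hg : Continuous g) (hk : Integrable k) (hB : ∀ x, ‖g x‖ ≤ B) (s t x : ℝ) :
    smooth g k s x - smooth g k s (x + t) = smooth (fun u => g u - g (u + t)) k s x := by
  rw [smooth, smooth, ← integral_sub (integrable_smooth hg hk hB s x)
    (integrable_smooth hg hk hB s (x + t)), smooth]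
  congr 1
  ext v
  rw [show x + t - s * v = x - s * v + t by ring]
  ring

lemma tendsto_mean_smooth (hg : Continuous g) (hk : Integrable k) (hB : ∀ x, ‖g x‖ ≤ B)
    (s lam : ℝ) :
    Tendsto (fun T : ℝ => (1 / (2 * (T : ℂ))) * (∫ x in (-T)..T, smooth g k s x * osc lam x)
      - (∫ v, osc lam (s * v) * k v) *
        ((1 / (2 * (T : ℂ))) * ∫ x in (-T)..T, g x * osc lam x)) atTop (𝓝 0) := by
  have hB0 : 0 ≤ B := (norm_nonneg _).trans (hB 0)
  have hgo : Continuous fun x => g x * osc lam x := hg.mul (continuous_osc lam)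
  have hgi : ∀ a b, IntervalIntegrable (fun x => g x * osc lam x) volume a b :=
    fun a b => hgo.intervalIntegrable a b
  have hgb : ∀ a b : ℝ, ‖∫ x in a..b, g x * osc lam x‖ ≤ B * |b - a| := fun a b =>
    intervalIntegral.norm_integral_le_of_norm_le_const fun x _ => by
      rw [norm_mul, norm_osc, mul_one]
      exact hB x
  have hko : Integrable fun v => osc lam (s * v) * k v :=
    hk.bdd_mul (c := 1) (by have := continuous_osc lam; fun_prop)
      (ae_of_all _ fun v => (norm_osc _ _).le)
  -- the difference as a single integral
  set J : ℝ → ℝ → ℂ := fun T v => (∫ x in (-T - s * v)..(T - s * v), g x * osc lam x)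
    - ∫ x in (-T)..T, g x * osc lam x with hJ
  have hJ1 : ∀ T v, ‖J T v‖ ≤ 2 * B * |s * v| := by
    intro T v
    have e1 := intervalIntegral.integral_add_adjacent_intervals (hgi (-T - s * v) (-T))
      (hgi (-T) (T - s * v))
    have e2 := intervalIntegral.integral_add_adjacent_intervals (hgi (-T) (T - s * v))
      (hgi (T - s * v) T)
    have : J T v = (∫ x in (-T - s * v)..(-T), g x * osc lam x)
        - ∫ x in (T - s * v)..T, g x * osc lam x := by
      rw [hJ]
      linear_combination e2 - e1
    rw [this]
    refine (norm_sub_le _ _).trans ?_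
    have n1 := hgb (-T - s * v) (-T)
    have n2 := hgb (T - s * v) T
    rw [show -T - (-T - s * v) = s * v by ring] at n1
    rw [show T - (T - s * v) = s * v by ring] at n2
    linarith
  have hJ2 : ∀ T v, 0 < T → ‖J T v‖ ≤ 4 * B * T := by
    intro T v hT
    refine (norm_sub_le _ _).trans ?_
    have n1 := hgb (-T - s * v) (T - s * v)
    have n2 := hgb (-T) T
    rw [show T - s * v - (-T - s * v) = 2 * T by ring, abs_of_pos (by positivity)] at n1
    rw [show T - -T = 2 * T by ring, abs_of_pos (by positivity)] at n2
    linarith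
  have hJc : ∀ T, Continuous (J T) := by
    intro T
    have hP : Continuous fun x => ∫ u in (0 : ℝ)..x, g u * osc lam u :=
      intervalIntegral.continuous_primitive hgi 0
    have : J T = fun v => (∫ u in (0 : ℝ)..(T - s * v), g u * osc lam u)
        - (∫ u in (0 : ℝ)..(-T - s * v), g u * osc lam u) - ∫ x in (-T)..T, g x * osc lam x := by
      ext v
      rw [hJ, intervalIntegral.integral_interval_sub_left (hgi _ _) (hgi _ _)]
    rw [this]
    exact ((hP.comp (by fun_prop)).sub (hP.comp (by fun_prop))).sub continuous_const
  have key : ∀ T : ℝ, 0 < T → (1 / (2 * (T : ℂ))) * (∫ x in (-T)..T, smooth g k s x * osc lam x)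
      - (∫ v, osc lam (s * v) * k v) * ((1 / (2 * (T : ℂ))) * ∫ x in (-T)..T, g x * osc lam x)
      = ∫ v, (1 / (2 * (T : ℂ))) * J T v * (osc lam (s * v) * k v) := by
    intro T hT
    have f1 : ∫ x in (-T)..T, smooth g k s x * osc lam x
        = ∫ v, (∫ x in (-T - s * v)..(T - s * v), g x * osc lam x) * (osc lam (s * v) * k v) := by
      have : ∀ x, smooth g k s x * osc lam x = ∫ v, g (x - s * v) * k v * osc lam x := fun x =>
        (integral_mul_const _ _).symm
      simp only [this]
      rw [intervalIntegral_integral_swap]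
      · congr 1
        ext v
        have := integral_osc_shift lam (-T - s * v) (T - s * v) (s * v)
          (fun x => g (x - s * v))
        simp only [sub_add_cancel, add_sub_cancel_right] at this
        have e3 : ∀ x, g (x - s * v) * k v * osc lam x = k v * (g (x - s * v) * osc lam x) :=
          fun x => by ring
        simp only [e3]
        rw [intervalIntegral.integral_const_mul, this]
        ring
      · have : IsFiniteMeasure (volume.restrict (Set.uIoc (-T) T)) := by
          rw [Set.uIoc]
          infer_instance
        have h1 : Integrable (fun z : ℝ × ℝ => (1 : ℂ) * k z.2)
            ((volume.restrict (Set.uIoc (-T) T)).prod volume) :=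
          (integrable_const (1 : ℂ)).mul_prod hk
        have h2 := h1.bdd_mul (c := B) (f := fun z : ℝ × ℝ => g (z.1 - s * z.2) * osc lam z.1)
          (by have := continuous_osc lam; fun_prop) (ae_of_all _ fun z => by
            rw [norm_mul, norm_osc, mul_one]
            exact hB _)
        refine h2.congr (ae_of_all _ fun z => ?_)
        simp only [Function.uncurry]
        ring
    have hJi : Integrable fun v => J T v * (osc lam (s * v) * k v) :=
      hko.bdd_mul (hJc T).aestronglyMeasurable (ae_of_all _ fun v => hJ2 T v hT)
    have f2 : ∫ v, J T v * (osc lam (s * v) * k v)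
        = (∫ x in (-T)..T, smooth g k s x * osc lam x)
          - (∫ v, osc lam (s * v) * k v) * ∫ x in (-T)..T, g x * osc lam x := by
      rw [f1, eq_sub_iff_add_eq, ← integral_mul_const, ← integral_add hJi (hko.mul_const _)]
      congr 1
      ext v
      rw [hJ]
      ring
    simp only [mul_assoc]
    rw [integral_const_mul, f2]
    ring
  have lim : Tendsto (fun T : ℝ => ∫ v, (1 / (2 * (T : ℂ))) * J T v * (osc lam (s * v) * k v)) atTop
      (𝓝 (∫ _ : ℝ, (0 : ℂ))) := by
    have hn : ∀ T : ℝ, 0 < T → ‖1 / (2 * (T : ℂ))‖ = 1 / (2 * T) := by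
      intro T hT
      rw [norm_div, norm_mul, Complex.norm_real, Real.norm_eq_abs, abs_of_pos hT]
      simp
    refine tendsto_integral_filter_of_dominated_convergence (fun v => 2 * B * ‖k v‖) ?_ ?_
      (hk.norm.const_mul _) (ae_of_all _ fun v => ?_)
    · exact Eventually.of_forall fun T =>
        (continuous_const.mul (hJc T)).aestronglyMeasurable.mul hko.aestronglyMeasurable
    · filter_upwards [Ioi_mem_atTop 0] with T (hT : 0 < T)
      refine ae_of_all _ fun v => ?_
      rw [norm_mul, norm_mul, norm_mul, norm_osc, one_mul, hn T hT]
      refine mul_le_mul_of_nonneg_right ?_ (norm_nonneg _)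
      rw [one_div, inv_mul_le_iff₀ (by positivity)]
      refine (hJ2 T v hT).trans_eq (by ring)
    · refine squeeze_zero_norm' ?_ (tendsto_const_div_atTop (B * |s * v| * ‖k v‖))
      filter_upwards [Ioi_mem_atTop 0] with T (hT : 0 < T)
      rw [norm_mul, norm_mul, norm_mul, norm_osc, one_mul, hn T hT]
      have := hJ1 T v
      calc 1 / (2 * T) * ‖J T v‖ * ‖k v‖ ≤ 1 / (2 * T) * (2 * B * |s * v|) * ‖k v‖ := by gcongr
        _ = B * |s * v| * ‖k v‖ / T := by field_simp
  rw [integral_zero] at lim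
  refine lim.congr' ?_
  filter_upwards [Ioi_mem_atTop 0] with T hT
  exact (key T hT).symm

end smooth

/-! ### The Poisson kernel -/

/-- The Poisson kernel `1 / (π (1 + v²))`. -/
def poissonKer (v : ℝ) : ℝ := (1 + v ^ 2)⁻¹ / Real.pi

lemma poissonKer_nonneg (v : ℝ) : 0 ≤ poissonKer v := by
  unfold poissonKer
  positivity

lemma integrable_poissonKer : Integrable poissonKer := integrable_inv_one_add_sq.div_const _

lemma integral_poissonKer : ∫ v, poissonKer v = 1 := by
  unfold poissonKer
  rw [integral_div, integral_univ_inv_one_add_sq, div_self Real.pi_ne_zero]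

lemma integrable_exp_neg_abs : Integrable fun x : ℝ => (Real.exp (-(2 * Real.pi * |x|)) : ℂ) := by
  suffices h : Integrable fun x : ℝ => Real.exp (-(2 * Real.pi * |x|)) from h.ofReal
  rw [← integrableOn_univ, ← Iic_union_Ioi (a := (0 : ℝ))]
  refine IntegrableOn.union ?_ ?_
  · refine (integrableOn_exp_mul_Iic (a := 2 * Real.pi) (by positivity) 0).congr_fun ?_
      measurableSet_Iic
    intro x (hx : x ≤ 0)
    simp only [abs_of_nonpos hx]
    ring_nf
  · refine (integrableOn_exp_mul_Ioi (a := -(2 * Real.pi)) (by linarith [Real.pi_pos]) 0).congr_fun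
      ?_ measurableSet_Ioi
    intro x (hx : 0 < x)
    simp only [abs_of_pos hx]
    ring_nf

open FourierTransform in
lemma fourier_exp_neg_abs :
    𝓕 (fun x : ℝ => (Real.exp (-(2 * Real.pi * |x|)) : ℂ)) = fun v => (poissonKer v : ℂ) := by
  ext v
  rw [Real.fourier_real_eq_integral_exp_smul]
  have hpi := Real.pi_pos
  have hpi' : (Real.pi : ℂ) ≠ 0 := by exact_mod_cast hpi.ne'
  set a : ℂ := 2 * Real.pi - 2 * Real.pi * v * Complex.I with ha
  set b : ℂ := -(2 * Real.pi) - 2 * Real.pi * v * Complex.I with hb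
  have har : 0 < a.re := by simp [ha, hpi]
  have hbr : b.re < 0 := by simp [hb, hpi]
  set F : ℝ → ℂ := fun x => Complex.exp (((-2 * Real.pi * x * v : ℝ) : ℂ) * Complex.I) •
    (Real.exp (-(2 * Real.pi * |x|)) : ℂ) with hF
  have f1 : EqOn (fun x : ℝ => Complex.exp (a * x)) F (Iic 0) := by
    intro x (hx : x ≤ 0)
    simp only [hF, abs_of_nonpos hx, smul_eq_mul, Complex.ofReal_exp, ← Complex.exp_add, ha]
    congr 1
    push_cast
    ring
  have f2 : EqOn (fun x : ℝ => Complex.exp (b * x)) F (Ioi 0) := by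
    intro x (hx : 0 < x)
    simp only [hF, abs_of_pos hx, smul_eq_mul, Complex.ofReal_exp, ← Complex.exp_add, hb]
    congr 1
    push_cast
    ring
  have i1 := (integrableOn_exp_mul_complex_Iic har 0).congr_fun f1 measurableSet_Iic
  have i2 := (integrableOn_exp_mul_complex_Ioi hbr 0).congr_fun f2 measurableSet_Ioi
  rw [← intervalIntegral.integral_Iic_add_Ioi i1 i2, ← setIntegral_congr_fun measurableSet_Iic f1,
    ← setIntegral_congr_fun measurableSet_Ioi f2, integral_exp_mul_complex_Iic har,
    integral_exp_mul_complex_Ioi hbr]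
  have ha0 : a ≠ 0 := fun h => by simp [h] at har
  have hb0 : b ≠ 0 := fun h => by simp [h] at hbr
  have hv : (1 : ℂ) + (v : ℂ) ^ 2 ≠ 0 := by
    exact_mod_cast (by positivity : (1 : ℝ) + v ^ 2 ≠ 0)
  have hab : a * b = -(4 * Real.pi ^ 2 * (1 + (v : ℂ) ^ 2)) := by
    rw [ha, hb]
    linear_combination (4 * (Real.pi : ℂ) ^ 2 * v ^ 2) * Complex.I_sq
  have hba : b - a = -(4 * Real.pi) := by rw [ha, hb]; ring
  have : (1 : ℂ) / a + -1 / b = (b - a) / (a * b) := by field_simp; ring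
  simp only [Complex.ofReal_zero, mul_zero, Complex.exp_zero]
  rw [this, hab, hba, poissonKer]
  push_cast
  field_simp

open FourierTransform in
lemma integral_osc_poissonKer (ξ : ℝ) :
    ∫ v, osc ξ v * (poissonKer v : ℂ) = (Real.exp (-(2 * Real.pi * |ξ|)) : ℂ) := by
  have hc : Continuous fun x : ℝ => (Real.exp (-(2 * Real.pi * |x|)) : ℂ) := by fun_prop
  have h := hc.fourierInv_fourier_eq integrable_exp_neg_abs
    (by rw [fourier_exp_neg_abs]; exact integrable_poissonKer.ofReal)
  rw [fourier_exp_neg_abs, Real.fourierInv_eq_fourier_comp_neg] at h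
  have h' := congrFun h ξ
  rw [Real.fourier_real_eq_integral_exp_smul] at h'
  rw [← h']
  congr 1
  ext v
  rw [osc, smul_eq_mul]
  congr 2
  · push_cast
    ring
  · simp [poissonKer]

/-! ### Growth of almost periodic functions with spectrum bounded below -/

lemma tendsto_meanR_of_tendsto_meanAt {f : ℂ → ℂ} {y lam : ℝ} (h : HasMeanAt f y lam 0) :
    Tendsto (fun T : ℝ => (1 / (2 * (T : ℂ))) *
      ∫ x in (-T)..T, f ((x : ℂ) + (y : ℂ) * Complex.I) * osc lam x) atTop (𝓝 0) := by
  have h1 := ((hasMeanAt_iff f y lam 0).1 h).const_mul ((Real.exp (-(2 * Real.pi * lam * y)) : ℂ))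
  rw [mul_zero] at h1
  refine h1.congr fun T => ?_
  rw [meanAt_eq_osc, ← mul_assoc, ← Complex.ofReal_mul, ← Real.exp_add]
  simp

theorem APH.norm_le_of_spec {f : ℂ → ℂ} (hf : APH f) {A : ℝ} (hA : ∀ lam ∈ specH f, -A ≤ lam) :
    ∃ M ≥ (0 : ℝ), ∀ z : ℂ, 1 ≤ z.im → ‖f z‖ ≤ M * Real.exp (2 * Real.pi * A * (z.im - 1)) := by
  obtain ⟨M, hM0, hM⟩ := hf.bounded_strip one_pos le_rfl
  refine ⟨M, hM0, fun z hz => ?_⟩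
  set y := z.im with hy
  set s := y - 1 with hs
  have hs0 : 0 ≤ s := by linarith
  have hy0 : 0 < y := by linarith
  set g : ℝ → ℂ := fun x => f ((x : ℂ) + ((1 : ℝ) : ℂ) * Complex.I) with hg
  have hgc : Continuous g := hf.continuous_slice one_pos
  have hgB : ∀ x, ‖g x‖ ≤ M := fun x => hM _ (by simp) (by simp)
  set k : ℝ → ℂ := fun v => osc (A * s) v * (poissonKer v : ℂ) with hk
  have hki : Integrable k := integrable_poissonKer.ofReal.bdd_mul (c := 1)
    (continuous_osc _).aestronglyMeasurable (ae_of_all _ fun v => (norm_osc _ _).le)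
  have hkn : ∀ v, ‖k v‖ = poissonKer v := fun v => by
    rw [hk, norm_mul, norm_osc, one_mul, Complex.norm_real, Real.norm_eq_abs,
      abs_of_nonneg (poissonKer_nonneg v)]
  have hk1 : ∫ v, ‖k v‖ = 1 := by simp only [hkn, integral_poissonKer]
  have hkosc : ∀ lam, ∫ v, osc lam (s * v) * k v = (Real.exp (-(2 * Real.pi * |s * (lam + A)|)) : ℂ) := by
    intro lam
    rw [← integral_osc_poissonKer]
    congr 1
    ext v
    rw [hk, ← mul_assoc]
    congr 1
    simp only [osc, ← Complex.exp_add]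
    congr 1
    push_cast
    ring
  set E := Real.exp (2 * Real.pi * A * s) with hE
  have hE0 : 0 < E := Real.exp_pos _
  set D : ℝ → ℂ := fun x => f ((x : ℂ) + (y : ℂ) * Complex.I) - E * smooth g k s x with hD
  have hDc : Continuous D := (hf.continuous_slice hy0).sub
    (continuous_const.mul (continuous_smooth hgc hki hgB s))
  have hDapr : APR D := by
    refine ⟨hDc, fun ε hε => ?_⟩
    obtain ⟨τ, ⟨l, hl, hτ⟩, h⟩ := hf.2 (1 / 2) (y + 1) (ε / (1 + E)) (by norm_num) (by linarith)
      (by positivity)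
    refine ⟨l, hl, fun x => ?_⟩
    obtain ⟨t, ht, h1, h2⟩ := hτ x
    refine ⟨t, fun u => ?_, h1, h2⟩
    have n1 := h t ht ((u : ℂ) + (y : ℂ) * Complex.I) (by simp; linarith) (by simp)
    have n2 : ∀ u, ‖(fun u => g u - g (u + t)) u‖ ≤ ε / (1 + E) := by
      intro u
      have := h t ht ((u : ℂ) + ((1 : ℝ) : ℂ) * Complex.I) (by simp; norm_num) (by simp; linarith)
      convert this using 3
      simp only [hg]
      congr 1
      push_cast
      ring
    have n3 := norm_smooth_le n2 hki s u
    rw [hk1, mul_one, ← smooth_sub_smooth hgc hki hgB] at n3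
    have e : D u - D (u + t) = (f ((u : ℂ) + (y : ℂ) * Complex.I)
        - f ((u : ℂ) + (y : ℂ) * Complex.I + t)) - E * (smooth g k s u - smooth g k s (u + t)) := by
      simp only [hD]
      rw [show (((u + t : ℝ) : ℂ) + (y : ℂ) * Complex.I) = (u : ℂ) + (y : ℂ) * Complex.I + t by
        push_cast; ring]
      ring
    rw [e]
    refine (norm_sub_le _ _).trans ?_
    rw [norm_mul, Complex.norm_real, Real.norm_eq_abs, abs_of_pos hE0]
    calc _ ≤ ε / (1 + E) + E * (ε / (1 + E)) := by gcongr
      _ = ε := by field_simp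
  have hDm : ∀ lam, FreqMeanZero D lam := by
    intro lam
    refine freqMeanZero_of_tendsto le_rfl ?_
    set my : ℝ → ℂ := fun T => (1 / (2 * (T : ℂ))) *
      ∫ x in (-T)..T, f ((x : ℂ) + (y : ℂ) * Complex.I) * osc lam x with hmy
    set m1 : ℝ → ℂ := fun T => (1 / (2 * (T : ℂ))) * ∫ x in (-T)..T, g x * osc lam x with hm1
    set ms : ℝ → ℂ := fun T => (1 / (2 * (T : ℂ))) *
      ∫ x in (-T)..T, smooth g k s x * osc lam x with hms
    set c : ℂ := (Real.exp (-(2 * Real.pi * |s * (lam + A)|)) : ℂ) with hc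
    have t1 : Tendsto (fun T => ms T - c * m1 T) atTop (𝓝 0) := by
      have := tendsto_mean_smooth hgc hki hgB s lam
      rwa [hkosc] at this
    have t2 : Tendsto (fun T => my T - E * (c * m1 T)) atTop (𝓝 0) := by
      rcases le_or_gt (-A) lam with h | h
      · obtain ⟨M', -, hM'⟩ := hf.bounded_strip one_pos hz
        have := (tendsto_meanAt_sub hz (hf.1.mono fun w hw => one_pos.trans_le hw.1) hM'
          lam).const_mul (Real.exp (-(2 * Real.pi * lam * y)) : ℂ)
        rw [mul_zero] at this
        refine this.congr fun T => ?_
        have a1 : (Real.exp (-(2 * Real.pi * lam * y)) : ℂ) * Real.exp (2 * Real.pi * lam * y)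
            = 1 := by
          rw [← Complex.ofReal_mul, ← Real.exp_add]
          simp
        have a2 : (Real.exp (-(2 * Real.pi * lam * y)) : ℂ) * Real.exp (2 * Real.pi * lam * 1)
            = E * c := by
          rw [hc, hE, ← Complex.ofReal_mul, ← Complex.ofReal_mul, ← Real.exp_add, ← Real.exp_add,
            abs_of_nonneg (mul_nonneg hs0 (by linarith)), hs]
          ring_nf
        rw [meanAt_eq_osc, meanAt_eq_osc]
        linear_combination my T * a1 - m1 T * a2
      · have hlam : ∀ y > 0, HasMeanAt f y lam 0 := by
          by_contra! hcon
          exact absurd (hA lam hcon) (by linarith)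
        have u1 := tendsto_meanR_of_tendsto_meanAt (hlam y hy0)
        have u2 := tendsto_meanR_of_tendsto_meanAt (hlam 1 one_pos)
        have := u1.sub ((u2.const_mul c).const_mul (E : ℂ))
        rw [mul_zero, mul_zero, sub_zero] at this
        exact this
    have t3 := t2.sub (t1.const_mul (E : ℂ))
    rw [mul_zero, sub_zero] at t3
    refine t3.congr fun T => ?_
    have i1 : IntervalIntegrable (fun x : ℝ => f ((x : ℂ) + (y : ℂ) * Complex.I) * osc lam x)
        volume (-T) T := ((hf.continuous_slice hy0).mul (continuous_osc lam)).intervalIntegrable _ _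
    have i2 : IntervalIntegrable (fun x : ℝ => (E : ℂ) * (smooth g k s x * osc lam x))
        volume (-T) T := (continuous_const.mul
          ((continuous_smooth hgc hki hgB s).mul (continuous_osc lam))).intervalIntegrable _ _
    have : ∀ x, D x * osc lam x = f ((x : ℂ) + (y : ℂ) * Complex.I) * osc lam x
        - E * (smooth g k s x * osc lam x) := fun x => by rw [hD]; ring
    simp only [this]
    rw [intervalIntegral.integral_sub i1 i2, intervalIntegral.integral_const_mul]
    ring
  have h0 := hDapr.eq_zero hDm z.re
  rw [hD, sub_eq_zero, hy, Complex.re_add_im] at h0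
  rw [h0, norm_mul, Complex.norm_real, Real.norm_eq_abs, abs_of_pos hE0, mul_comm]
  have := norm_smooth_le hgB hki s z.re
  rw [hk1, mul_one] at this
  gcongr

/-! ### Exponential growth -/

lemma norm_fstar (f : ℂ → ℂ) (z : ℂ) : ‖fstar f z‖ = ‖f ((starRingEnd ℂ) z)‖ :=
  RCLike.norm_conj _

lemma norm_eq_norm_fstar (f : ℂ → ℂ) (z : ℂ) : ‖f z‖ = ‖fstar f ((starRingEnd ℂ) z)‖ := by
  rw [norm_fstar, Complex.conj_conj]

lemma differentiable_fstar {f : ℂ → ℂ} (hf : Differentiable ℂ f) : Differentiable ℂ (fstar f) :=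
  fun z => by
    have h := (hf ((starRingEnd ℂ) z)).conj_conj
    rw [Complex.conj_conj] at h
    exact h

lemma exists_norm_le_exp_of_spec {f : ℂ → ℂ} (hAP : APH f) (hb : BddBelow (specH f)) :
    ∃ M ≥ (0 : ℝ), ∃ B ≥ (0 : ℝ), ∀ z : ℂ, 1 ≤ z.im → ‖f z‖ ≤ M * Real.exp (B * z.im) := by
  obtain ⟨m, hm⟩ := hb
  obtain ⟨M, hM0, hM⟩ := hAP.norm_le_of_spec (A := |m|) fun lam hlam =>
    (neg_abs_le m).trans (hm hlam)
  refine ⟨M, hM0, 2 * Real.pi * |m|, by positivity, fun z hz => (hM z hz).trans ?_⟩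
  gcongr
  linarith

lemma rpow_le_exp {ρ x : ℝ} (hx : 1 ≤ x) : x ^ ρ ≤ (⌈ρ⌉₊.factorial : ℝ) * Real.exp x := by
  have h1 : x ^ ρ ≤ x ^ (⌈ρ⌉₊ : ℝ) := Real.rpow_le_rpow_of_exponent_le hx (Nat.le_ceil ρ)
  rw [Real.rpow_natCast] at h1
  have h2 := Real.pow_div_factorial_le_exp x (by linarith) ⌈ρ⌉₊
  rw [div_le_iff₀ (by positivity)] at h2
  linarith

lemma exists_norm_le_exp_im {f : ℂ → ℂ} (hf : Differentiable ℂ f)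
    (hAP : APH f) (hAPs : APH (fstar f))
    (hb1 : BddBelow (specH f)) (hb2 : BddBelow (specH (fstar f)))
    (horder : ∃ ρ > (0:ℝ), ∃ C c : ℝ, ∀ z : ℂ, ‖f z‖ ≤ C * Real.exp (c * ‖z‖ ^ ρ)) :
    ∃ C ≥ (0 : ℝ), ∃ B ≥ (0 : ℝ), ∀ z : ℂ, ‖f z‖ ≤ C * Real.exp (B * |z.im|) := by
  obtain ⟨M₁, hM₁, B₁, hB₁, h₁⟩ := exists_norm_le_exp_of_spec hAP hb1
  obtain ⟨M₂, hM₂, B₂, hB₂, h₂⟩ := exists_norm_le_exp_of_spec hAPs hb2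
  obtain ⟨ρ, hρ, C, c, hC⟩ := horder
  have h₂' : ∀ z : ℂ, z.im ≤ -1 → ‖f z‖ ≤ M₂ * Real.exp (B₂ * -z.im) := by
    intro z hz
    rw [norm_eq_norm_fstar]
    simpa using h₂ ((starRingEnd ℂ) z) (by simp; linarith)
  set K := max (M₁ * Real.exp B₁) (M₂ * Real.exp B₂) with hK
  have strip : ∀ z : ℂ, -1 ≤ z.im → z.im ≤ 1 → ‖f z‖ ≤ K := by
    intro z hz1 hz2
    refine PhragmenLindelof.horizontal_strip (a := -1) (b := 1) hf.diffContOnCl ?_ ?_ ?_ hz1 hz2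
    · refine ⟨1, by linarith [Real.pi_gt_three], |c| * ((⌈ρ⌉₊.factorial : ℝ) * Real.exp 1), ?_⟩
      refine Asymptotics.IsBigO.of_bound |C| ?_
      filter_upwards [mem_inf_of_right (mem_principal_self _)] with w hw
      have hw1 : |w.im| ≤ 1 := abs_le.2 ⟨hw.1.le, hw.2.le⟩
      have hwn : ‖w‖ ≤ |w.re| + 1 := (Complex.norm_le_abs_re_add_abs_im w).trans (by linarith)
      rw [Real.norm_eq_abs, Real.abs_exp]
      have hp : ‖w‖ ^ ρ ≤ (⌈ρ⌉₊.factorial : ℝ) * Real.exp 1 * Real.exp (1 * |w.re|) := by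
        calc ‖w‖ ^ ρ ≤ (|w.re| + 1) ^ ρ := by gcongr
          _ ≤ (⌈ρ⌉₊.factorial : ℝ) * Real.exp (|w.re| + 1) :=
            rpow_le_exp (by linarith [abs_nonneg w.re])
          _ = _ := by rw [Real.exp_add, one_mul]; ring
      have hcp : c * ‖w‖ ^ ρ ≤
          |c| * ((⌈ρ⌉₊.factorial : ℝ) * Real.exp 1) * Real.exp (1 * |w.re|) := by
        rw [mul_assoc]
        exact mul_le_mul (le_abs_self c) hp (by positivity) (abs_nonneg c)
      exact (hC w).trans (mul_le_mul (le_abs_self C) (Real.exp_le_exp.2 hcp)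
        (Real.exp_pos _).le (abs_nonneg C))
    · intro w hw
      have := h₂' w hw.le
      rw [hw, neg_neg, mul_one] at this
      exact this.trans (le_max_right _ _)
    · intro w hw
      have := h₁ w hw.ge
      rw [hw, mul_one] at this
      exact this.trans (le_max_left _ _)
  refine ⟨K, (by positivity : 0 ≤ M₁ * Real.exp B₁).trans (le_max_left _ _), max B₁ B₂,
    hB₁.trans (le_max_left _ _), fun z => ?_⟩
  have hK1 : M₁ ≤ K := (le_mul_of_one_le_right hM₁ (Real.one_le_exp hB₁)).trans (le_max_left _ _)
  have hK2 : M₂ ≤ K := (le_mul_of_one_le_right hM₂ (Real.one_le_exp hB₂)).trans (le_max_right _ _)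
  have hK0 : 0 ≤ K := hM₁.trans hK1
  rcases le_total 1 z.im with h | h
  · refine (h₁ z h).trans ?_
    gcongr
    · exact le_max_left _ _
    · exact le_abs_self _
  rcases le_total z.im (-1) with h' | h'
  · refine (h₂' z h').trans ?_
    have := neg_le_abs z.im
    gcongr
    · linarith
    · exact le_max_right _ _
  · refine (strip z h' h).trans (le_mul_of_one_le_right hK0 (Real.one_le_exp ?_))
    exact mul_nonneg (hB₁.trans (le_max_left _ _)) (abs_nonneg _)

section ExpIm

variable {g : ℂ → ℂ} {C B M : ℝ}

lemma norm_le_of_eventually_le_exp (hg : Differentiable ℂ g)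
    (hC : ∀ z : ℂ, ‖g z‖ ≤ C * Real.exp (B * |z.im|)) (hM : ∀ x : ℝ, ‖g x‖ ≤ M) {a : ℝ}
    (ha : ∀ᶠ y : ℝ in atTop, ‖g ((y : ℂ) * Complex.I)‖ ≤ Real.exp (a * y)) {z : ℂ}
    (hz : 0 ≤ z.im) : ‖g z‖ ≤ M * Real.exp (a * z.im) := by
  set F : ℂ → ℂ := fun w => g (w * Complex.I) * Complex.exp (-(a * w)) with hF
  have hn : ∀ w, ‖F w‖ = ‖g (w * Complex.I)‖ * Real.exp (-(a * w.re)) := by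
    intro w
    rw [hF, norm_mul, Complex.norm_exp]
    simp
  have key : ‖F (-(z * Complex.I))‖ ≤ M := by
    refine PhragmenLindelof.right_half_plane_of_bounded_on_real ?_ ?_ ?_ ?_ ?_
    · exact (by fun_prop : Differentiable ℂ F).diffContOnCl
    · refine ⟨1, by norm_num, |B| + |a|, Asymptotics.IsBigO.of_bound |C| ?_⟩
      refine Eventually.of_forall fun w => ?_
      rw [hn, Real.norm_eq_abs, Real.abs_exp, Real.rpow_one]
      have h1 := hC (w * Complex.I)
      have e : (w * Complex.I).im = w.re := by simp
      rw [e] at h1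
      have hw := Complex.abs_re_le_norm w
      calc _ ≤ C * Real.exp (B * |w.re|) * Real.exp (-(a * w.re)) := by gcongr
        _ ≤ |C| * Real.exp (|B| * ‖w‖) * Real.exp (|a| * ‖w‖) := by
          gcongr
          · exact le_abs_self C
          · exact le_abs_self B
          · refine (neg_le_abs _).trans ?_
            rw [abs_mul]
            gcongr
        _ = _ := by rw [add_mul, Real.exp_add, mul_assoc]
    · refine isBoundedUnder_of_eventually_le (a := 1) ?_
      filter_upwards [ha] with y hy
      rw [hn, Complex.ofReal_re]
      calc _ ≤ Real.exp (a * y) * Real.exp (-(a * y)) := by gcongr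
        _ = 1 := by rw [← Real.exp_add, add_neg_cancel, Real.exp_zero]
    · intro x
      rw [hn, mul_assoc, Complex.I_mul_I]
      have := hM (-x)
      simpa using this
    · simpa using hz
  rw [hn] at key
  have e1 : -(z * Complex.I) * Complex.I = z := by
    linear_combination (-z) * Complex.I_sq
  have e2 : (-(z * Complex.I)).re = z.im := by simp
  rw [e1, e2, Real.exp_neg, ← div_eq_mul_inv, div_le_iff₀ (Real.exp_pos _)] at key
  exact key

lemma le_exp_of_log_div_le {r a y : ℝ} (hr : 0 ≤ r) (hy : 0 < y) (h : Real.log r / y ≤ a) :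
    r ≤ Real.exp (a * y) := by
  rcases hr.eq_or_lt with rfl | hr
  · positivity
  · rw [← Real.log_le_iff_le_exp hr]
    rwa [div_le_iff₀ hy] at h

lemma log_div_le {r K b n : ℝ} (hr : 0 ≤ r) (hK : 1 ≤ K) (hb : 0 ≤ b) (hn : 0 < n)
    (h : r ≤ K * Real.exp (b * n)) : Real.log r / n ≤ Real.log K / n + b := by
  have hlK := Real.log_nonneg hK
  rcases hr.eq_or_lt with rfl | hr
  · simp only [Real.log_zero, zero_div]
    positivity
  · have := Real.log_le_log hr h
    rw [Real.log_mul (by positivity) (Real.exp_pos _).ne', Real.log_exp] at this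
    rw [div_add' _ _ _ hn.ne']
    gcongr

lemma norm_le_max_mul_exp (hC : ∀ z : ℂ, ‖g z‖ ≤ C * Real.exp (B * |z.im|)) (z : ℂ) :
    ‖g z‖ ≤ max C 1 * Real.exp (B * |z.im|) :=
  (hC z).trans (by gcongr; exact le_max_left _ _)

lemma isBoundedUnder_log_div (hB : 0 ≤ B)
    (hC : ∀ z : ℂ, ‖g z‖ ≤ C * Real.exp (B * |z.im|)) :
    IsBoundedUnder (· ≤ ·) (comap (fun z : ℂ => ‖z‖) atTop)
      (fun z : ℂ => Real.log ‖g z‖ / ‖z‖) := by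
  refine isBoundedUnder_of_eventually_le (a := Real.log (max C 1) + B) ?_
  filter_upwards [preimage_mem_comap (Ici_mem_atTop 1)] with z (hz : 1 ≤ ‖z‖)
  refine (log_div_le (norm_nonneg _) (le_max_right C 1) hB (by linarith)
    ((norm_le_max_mul_exp hC z).trans ?_)).trans ?_
  · have := Complex.abs_im_le_norm z
    gcongr
  · have := div_le_self (Real.log_nonneg (le_max_right C 1)) hz
    linarith

lemma tendsto_mul_I_comap {c : ℂ} (hc : ‖c‖ = 1) :
    Tendsto (fun y : ℝ => (y : ℂ) * c) atTop (comap (fun z : ℂ => ‖z‖) atTop) := by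
  rw [tendsto_comap_iff]
  refine tendsto_abs_atTop_atTop.congr fun y => ?_
  simp [hc]

lemma meanType_eq (g : ℂ → ℂ) : MeanType g = limsup (fun z : ℂ => Real.log ‖g z‖ / ‖z‖)
    (map (fun y : ℝ => (y : ℂ) * Complex.I) atTop) := by
  rw [MeanType]
  change _ = limsup (fun y : ℝ => Real.log ‖g ((y : ℂ) * Complex.I)‖ / ‖(y : ℂ) * Complex.I‖) atTop
  refine limsup_congr ?_
  filter_upwards [Ioi_mem_atTop 0] with y (hy : 0 < y)
  simp [abs_of_pos hy]

lemma meanType_fstar_eq (g : ℂ → ℂ) :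
    MeanType (fstar g) = limsup (fun z : ℂ => Real.log ‖g z‖ / ‖z‖)
      (map (fun y : ℝ => (y : ℂ) * -Complex.I) atTop) := by
  rw [MeanType]
  change _ = limsup (fun y : ℝ =>
    Real.log ‖g ((y : ℂ) * -Complex.I)‖ / ‖(y : ℂ) * -Complex.I‖) atTop
  refine limsup_congr ?_
  filter_upwards [Ioi_mem_atTop 0] with y (hy : 0 < y)
  rw [norm_fstar]
  simp [abs_of_pos hy]

lemma isBoundedUnder_log_div_mul_I (hB : 0 ≤ B)
    (hC : ∀ z : ℂ, ‖g z‖ ≤ C * Real.exp (B * |z.im|)) :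
    IsBoundedUnder (· ≤ ·) atTop
      (fun y : ℝ => Real.log ‖g ((y : ℂ) * Complex.I)‖ / y) := by
  obtain ⟨b, hb⟩ := (tendsto_mul_I_comap Complex.norm_I).isBoundedUnder_comp
    (isBoundedUnder_log_div hB hC)
  refine isBoundedUnder_of_eventually_le (a := b) ?_
  filter_upwards [eventually_map.1 hb, Ioi_mem_atTop 0] with y h1 (hy : 0 < y)
  simpa [abs_of_pos hy] using h1

lemma norm_le_exp_meanType (hg : Differentiable ℂ g) (hB : 0 ≤ B)
    (hC : ∀ z : ℂ, ‖g z‖ ≤ C * Real.exp (B * |z.im|)) (hM : ∀ x : ℝ, ‖g x‖ ≤ M) {z : ℂ}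
    (hz : 0 ≤ z.im) : ‖g z‖ ≤ M * Real.exp (MeanType g * z.im) := by
  have key : ∀ ε > 0, ‖g z‖ ≤ M * Real.exp ((MeanType g + ε) * z.im) := by
    intro ε hε
    refine norm_le_of_eventually_le_exp hg hC hM ?_ hz
    have := eventually_lt_of_limsup_lt (lt_add_of_pos_right (MeanType g) hε)
      (isBoundedUnder_log_div_mul_I hB hC)
    filter_upwards [this, Ioi_mem_atTop 0] with y h1 (hy : 0 < y)
    exact le_exp_of_log_div_le (norm_nonneg _) hy h1.le
  have lim : Tendsto (fun ε : ℝ => M * Real.exp ((MeanType g + ε) * z.im)) (𝓝[>] 0)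
      (𝓝 (M * Real.exp ((MeanType g + 0) * z.im))) :=
    ((by fun_prop : Continuous fun ε : ℝ => M * Real.exp ((MeanType g + ε) * z.im)).tendsto
      0).mono_left nhdsWithin_le_nhds
  rw [add_zero] at lim
  exact ge_of_tendsto lim (eventually_mem_nhdsWithin.mono key)

lemma isCoboundedUnder_log_div_mul_I (hg : Differentiable ℂ g)
    (hC : ∀ z : ℂ, ‖g z‖ ≤ C * Real.exp (B * |z.im|)) (hM : ∀ x : ℝ, ‖g x‖ ≤ M) :
    IsCoboundedUnder (· ≤ ·) (map (fun y : ℝ => (y : ℂ) * Complex.I) atTop)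
      (fun z : ℂ => Real.log ‖g z‖ / ‖z‖) := by
  by_contra hcon
  have hM0 : 0 ≤ M := (norm_nonneg _).trans (hM 0)
  have ev : ∀ N : ℝ, ∀ᶠ y : ℝ in atTop,
      Real.log ‖g ((y : ℂ) * Complex.I)‖ / y < N := by
    intro N
    by_contra h
    rw [not_eventually] at h
    refine hcon (IsCoboundedUnder.of_frequently_ge (a := N) ?_)
    rw [frequently_map]
    refine (h.and_eventually (Ioi_mem_atTop 0)).mono fun y hy => ?_
    have hy0 : 0 < y := hy.2
    simpa [abs_of_pos hy0] using hy.1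
  have zero : ∀ y : ℝ, 0 < y → g ((y : ℂ) * Complex.I) = 0 := by
    intro y hy
    have hN : ∀ N : ℝ, ‖g ((y : ℂ) * Complex.I)‖ ≤ M * Real.exp (N * y) := by
      intro N
      have := norm_le_of_eventually_le_exp (z := (y : ℂ) * Complex.I) (a := N) hg hC hM (by
        filter_upwards [ev N, Ioi_mem_atTop 0] with y h1 (hy : 0 < y)
        exact le_exp_of_log_div_le (norm_nonneg _) hy h1.le) (by simpa using hy.le)
      simpa using this
    have lim : Tendsto (fun N : ℝ => M * Real.exp (N * y)) atBot (𝓝 (M * 0)) :=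
      (Real.tendsto_exp_atBot.comp (tendsto_id.atBot_mul_const hy)).const_mul M
    rw [mul_zero] at lim
    exact norm_le_zero_iff.1 (ge_of_tendsto' lim hN)
  obtain ⟨y, h1, h2⟩ := ((ev (-1)).and (Ioi_mem_atTop (0 : ℝ))).exists
  rw [zero y h2] at h1
  norm_num at h1

end ExpIm

section ExpType

variable {g : ℂ → ℂ} {C B M : ℝ}

lemma norm_fstar_le (hC : ∀ z : ℂ, ‖g z‖ ≤ C * Real.exp (B * |z.im|)) (z : ℂ) :
    ‖fstar g z‖ ≤ C * Real.exp (B * |z.im|) := by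
  rw [norm_fstar]
  simpa using hC ((starRingEnd ℂ) z)

lemma norm_fstar_ofReal (g : ℂ → ℂ) (x : ℝ) : ‖fstar g x‖ = ‖g x‖ := by
  rw [norm_fstar, Complex.conj_ofReal]

lemma norm_le_exp_max_meanType (hg : Differentiable ℂ g) (hB : 0 ≤ B)
    (hC : ∀ z : ℂ, ‖g z‖ ≤ C * Real.exp (B * |z.im|)) (hM : ∀ x : ℝ, ‖g x‖ ≤ M) (z : ℂ) :
    ‖g z‖ ≤ M * Real.exp (max (MeanType g) (MeanType (fstar g)) * |z.im|) := by
  have hM0 : 0 ≤ M := (norm_nonneg _).trans (hM 0)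
  rcases le_total 0 z.im with h | h
  · refine (norm_le_exp_meanType hg hB hC hM h).trans ?_
    rw [abs_of_nonneg h]
    gcongr
    exact le_max_left _ _
  · rw [norm_eq_norm_fstar]
    refine (norm_le_exp_meanType (differentiable_fstar hg) hB (norm_fstar_le hC) (M := M)
      (fun x => (norm_fstar_ofReal g x).trans_le (hM x)) (by simpa using h)).trans ?_
    rw [abs_of_nonpos h, Complex.conj_im]
    have : 0 ≤ -z.im := by linarith
    gcongr
    exact le_max_right _ _

lemma max_meanType_nonneg (hg : Differentiable ℂ g) (hB : 0 ≤ B)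
    (hC : ∀ z : ℂ, ‖g z‖ ≤ C * Real.exp (B * |z.im|)) (hM : ∀ x : ℝ, ‖g x‖ ≤ M) :
    0 ≤ max (MeanType g) (MeanType (fstar g)) := by
  have hM0 : 0 ≤ M := (norm_nonneg _).trans (hM 0)
  by_contra! hneg
  have hle := norm_le_exp_max_meanType hg hB hC hM
  set τ := max (MeanType g) (MeanType (fstar g)) with hτ
  have hbdd : Bornology.IsBounded (range g) := by
    refine isBounded_iff_forall_norm_le.2 ⟨M, ?_⟩
    rintro _ ⟨z, rfl⟩
    refine (hle z).trans (mul_le_of_le_one_right hM0 (Real.exp_le_one_iff.2 ?_))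
    exact mul_nonpos_of_nonpos_of_nonneg hneg.le (abs_nonneg _)
  have hconst : ∀ z, g z = g 0 := fun z => hg.apply_eq_apply_of_bounded hbdd z 0
  have hlim : Tendsto (fun y : ℝ => M * Real.exp (τ * y)) atTop (𝓝 (M * 0)) :=
    (Real.tendsto_exp_atBot.comp (tendsto_id.const_mul_atTop_of_neg hneg)).const_mul M
  have h0 : g 0 = 0 := by
    rw [mul_zero] at hlim
    refine norm_le_zero_iff.1 (ge_of_tendsto hlim ?_)
    filter_upwards [Ioi_mem_atTop 0] with y (hy : 0 < y)
    have := hle ((y : ℂ) * Complex.I)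
    rw [hconst] at this
    simpa [abs_of_pos hy] using this
  have hm : MeanType g = 0 := by
    simp [MeanType, hconst, h0]
  have := le_max_left (MeanType g) (MeanType (fstar g))
  linarith

lemma limsup_log_div_eq (hg : Differentiable ℂ g) (hB : 0 ≤ B)
    (hC : ∀ z : ℂ, ‖g z‖ ≤ C * Real.exp (B * |z.im|)) (hM : ∀ x : ℝ, ‖g x‖ ≤ M) :
    limsup (fun z : ℂ => Real.log ‖g z‖ / ‖z‖) (comap (fun z : ℂ => ‖z‖) atTop) =
      max (MeanType g) (MeanType (fstar g)) := by
  have hMs : ∀ x : ℝ, ‖fstar g x‖ ≤ M := fun x => (norm_fstar_ofReal g x).trans_le (hM x)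
  have hbd := isBoundedUnder_log_div hB hC
  have hcob := isCoboundedUnder_log_div_mul_I hg hC hM
  have hle : map (fun y : ℝ => (y : ℂ) * Complex.I) atTop ≤ comap (fun z : ℂ => ‖z‖) atTop :=
    tendsto_mul_I_comap Complex.norm_I
  have hles : map (fun y : ℝ => (y : ℂ) * -Complex.I) atTop ≤ comap (fun z : ℂ => ‖z‖) atTop :=
    tendsto_mul_I_comap (by simp)
  refine le_antisymm ?_ (max_le ?_ ?_)
  · have hτ := max_meanType_nonneg hg hB hC hM
    have hlog := Real.log_nonneg (le_max_right M 1)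
    refine le_of_forall_pos_le_add fun ε hε => ?_
    refine limsup_le_of_le (IsCobounded.mono (map_mono hle) hcob) ?_
    filter_upwards [preimage_mem_comap (Ioi_mem_atTop (Real.log (max M 1) / ε)),
      preimage_mem_comap (Ioi_mem_atTop (0 : ℝ))] with z (hz : _ < ‖z‖) (hz0 : 0 < ‖z‖)
    rw [div_lt_iff₀ hε] at hz
    refine (log_div_le (norm_nonneg _) (le_max_right M 1) hτ hz0
      ((norm_le_exp_max_meanType hg hB hC hM z).trans ?_)).trans ?_
    · have := Complex.abs_im_le_norm z
      gcongr
      exact le_max_left _ _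
    · rw [add_comm]
      gcongr
      rw [div_le_iff₀ hz0]
      linarith
  · rw [meanType_eq]
    exact limsup_le_limsup_of_le hle hcob hbd
  · rw [meanType_fstar_eq]
    refine limsup_le_limsup_of_le hles ?_ hbd
    have h := isCoboundedUnder_log_div_mul_I (differentiable_fstar hg) (norm_fstar_le hC) hMs
    unfold IsCoboundedUnder at h ⊢
    rw [map_map] at h ⊢
    convert h using 2
    funext y
    simp [norm_fstar]

lemma boundedType_of_norm_le (hg : Differentiable ℂ g) (hB : 0 ≤ B)
    (hC : ∀ z : ℂ, ‖g z‖ ≤ C * Real.exp (B * |z.im|)) : BoundedType g := by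
  have hn : ∀ z : ℂ, ‖Complex.exp (Complex.I * B * z)‖ = Real.exp (-(B * z.im)) := by
    intro z
    rw [Complex.norm_exp]
    simp
  refine ⟨fun z => g z * Complex.exp (Complex.I * B * z), fun z => Complex.exp (Complex.I * B * z),
    Differentiable.differentiableOn (by fun_prop), Differentiable.differentiableOn (by fun_prop),
    ⟨C, fun z hz => ?_⟩, ⟨1, fun z hz => ?_⟩, fun z _ => Complex.exp_ne_zero _, fun z _ => ?_⟩
  · have hz : 0 < z.im := hz
    have h := hC z
    rw [abs_of_pos hz] at h
    rw [norm_mul, hn, Real.exp_neg, ← div_eq_mul_inv, div_le_iff₀ (Real.exp_pos _)]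
    exact h
  · have hz : 0 < z.im := hz
    rw [hn, Real.exp_le_one_iff]
    have := mul_nonneg hB hz.le
    linarith
  · rw [mul_div_cancel_right₀ _ (Complex.exp_ne_zero _)]

lemma tendsto_meanAt_sub_meanAt (hg : Differentiable ℂ g) (hB : 0 ≤ B)
    (hC : ∀ z : ℂ, ‖g z‖ ≤ C * Real.exp (B * |z.im|)) {a b : ℝ} (hab : a ≤ b) (lam : ℝ) :
    Tendsto (fun T => meanAt g b lam T - meanAt g a lam T) atTop (𝓝 0) := by
  refine tendsto_meanAt_sub (M := |C| * Real.exp (B * max |a| |b|)) hab hg.differentiableOn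
    (fun z h1 h2 => (hC z).trans ?_) lam
  have : |z.im| ≤ max |a| |b| := abs_le_max_abs_abs h1 h2
  gcongr
  exact le_abs_self C

lemma hasMeanAt_iff_of_le (hg : Differentiable ℂ g) (hB : 0 ≤ B)
    (hC : ∀ z : ℂ, ‖g z‖ ≤ C * Real.exp (B * |z.im|)) {a b : ℝ} (hab : a ≤ b) (lam : ℝ) (c : ℂ) :
    HasMeanAt g a lam c ↔ HasMeanAt g b lam c := by
  rw [hasMeanAt_iff, hasMeanAt_iff]
  have h := tendsto_meanAt_sub_meanAt hg hB hC hab lam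
  constructor
  · intro ha
    simpa using ha.add h
  · intro hb
    simpa using hb.sub h

lemma meanAt_fstar (g : ℂ → ℂ) (y lam T : ℝ) :
    meanAt (fstar g) y (-lam) T = (starRingEnd ℂ) (meanAt g (-y) lam T) := by
  unfold meanAt
  rw [map_mul, ← intervalIntegral.intervalIntegral_conj]
  congr 1
  · rw [show (1 / (2 * (T : ℂ))) = ((1 / (2 * T) : ℝ) : ℂ) by push_cast; rfl, Complex.conj_ofReal]
  · refine intervalIntegral.integral_congr fun x _ => ?_
    simp only [fstar, map_mul, ← Complex.exp_conj, map_neg, map_add, Complex.conj_ofReal,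
      Complex.conj_I, map_ofNat, Complex.ofReal_neg]
    congr 2
    · congr 2
      ring
    · ring

lemma hasMeanAt_fstar_iff (hg : Differentiable ℂ g) (hB : 0 ≤ B)
    (hC : ∀ z : ℂ, ‖g z‖ ≤ C * Real.exp (B * |z.im|)) {y : ℝ} (hy : 0 < y) (lam : ℝ) (c : ℂ) :
    HasMeanAt g y lam c ↔ HasMeanAt (fstar g) y (-lam) ((starRingEnd ℂ) c) := by
  rw [← hasMeanAt_iff_of_le hg hB hC (by linarith : -y ≤ y), hasMeanAt_iff, hasMeanAt_iff]
  have e : meanAt (fstar g) y (-lam) = fun T => (starRingEnd ℂ) (meanAt g (-y) lam T) :=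
    funext fun T => meanAt_fstar g y lam T
  rw [e]
  constructor
  · intro h
    exact (Complex.continuous_conj.tendsto c).comp h
  · intro h
    simpa [Function.comp_def] using
      (Complex.continuous_conj.tendsto ((starRingEnd ℂ) c)).comp h

lemma mem_specH_fstar_iff (hg : Differentiable ℂ g) (hB : 0 ≤ B)
    (hC : ∀ z : ℂ, ‖g z‖ ≤ C * Real.exp (B * |z.im|)) (lam : ℝ) :
    -lam ∈ specH (fstar g) ↔ lam ∈ specH g := by
  refine exists_congr fun y => and_congr_right fun hy => not_congr ?_
  rw [hasMeanAt_fstar_iff hg hB hC hy lam 0, map_zero]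

lemma norm_meanAt_le {K y lam T : ℝ} (hT : 0 < T)
    (hK : ∀ x : ℝ, ‖g ((x : ℂ) + (y : ℂ) * Complex.I)‖ ≤ K) :
    ‖meanAt g y lam T‖ ≤ K * Real.exp (2 * Real.pi * lam * y) := by
  have hgint : ‖∫ x in (-T)..T, g ((x : ℂ) + (y : ℂ) * Complex.I) * osc lam x‖ ≤
      K * |T - -T| := by
    refine intervalIntegral.norm_integral_le_of_norm_le_const fun x _ => ?_
    rw [norm_mul, norm_osc, mul_one]
    exact hK x
  rw [sub_neg_eq_add, abs_of_pos (by linarith)] at hgint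
  rw [meanAt_eq_osc, norm_mul, norm_mul, mul_comm, Complex.norm_real, Real.norm_eq_abs,
    Real.abs_exp]
  gcongr
  have e : ‖(1 / (2 * (T : ℂ)))‖ = 1 / (2 * T) := by
    simp [abs_of_pos hT]
  rw [e, one_div, inv_mul_le_iff₀ (by positivity)]
  linarith

lemma le_of_mem_specH (hg : Differentiable ℂ g) {τ : ℝ} (hτ : 0 ≤ τ)
    (hM : ∀ z : ℂ, ‖g z‖ ≤ M * Real.exp (τ * |z.im|)) {lam : ℝ} (hlam : lam ∈ specH g) :
    -(τ / (2 * Real.pi)) ≤ lam := by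
  by_contra! hlt
  have hneg : τ + 2 * Real.pi * lam < 0 := by
    have := Real.pi_pos
    rw [← neg_div, lt_div_iff₀ (by positivity)] at hlt
    linarith
  obtain ⟨y, hy, hne⟩ := hlam
  refine hne ?_
  rw [hasMeanAt_iff, Metric.tendsto_nhds]
  intro ε hε
  have hlim : Tendsto (fun Y : ℝ => M * Real.exp ((τ + 2 * Real.pi * lam) * Y)) atTop
      (𝓝 (M * 0)) :=
    (Real.tendsto_exp_atBot.comp (tendsto_id.const_mul_atTop_of_neg hneg)).const_mul M
  rw [mul_zero] at hlim
  obtain ⟨Y, hY, hyY⟩ := ((hlim.eventually (gt_mem_nhds (half_pos hε))).and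
    (eventually_ge_atTop y)).exists
  filter_upwards [(Metric.tendsto_nhds.1 (tendsto_meanAt_sub_meanAt hg hτ hM hyY lam)) _
    (half_pos hε), Ioi_mem_atTop 0] with T h1 (hT : 0 < T)
  rw [dist_zero_right] at h1 ⊢
  have h2 : ‖meanAt g Y lam T‖ ≤ M * Real.exp (τ * Y) * Real.exp (2 * Real.pi * lam * Y) := by
    refine norm_meanAt_le hT fun x => ?_
    have := hM ((x : ℂ) + (Y : ℂ) * Complex.I)
    simpa [abs_of_pos (hy.trans_le hyY)] using this
  rw [mul_assoc, ← Real.exp_add, ← add_mul] at h2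
  calc ‖meanAt g y lam T‖
      = ‖meanAt g Y lam T - (meanAt g Y lam T - meanAt g y lam T)‖ := by rw [sub_sub_cancel]
    _ ≤ ‖meanAt g Y lam T‖ + ‖meanAt g Y lam T - meanAt g y lam T‖ := norm_sub_le _ _
    _ < ε := by linarith

end ExpType

/-! ### Almost periodic functions with finite spectrum -/

/-- The truncated Bohr mean `(1/2T)∫_{-T}^{T} g(x) e^{-2πiλx} dx`. -/
def meanR (g : ℝ → ℂ) (lam T : ℝ) : ℂ :=
  (1 / (2 * (T : ℂ))) * ∫ x in (-T)..T, g x * osc lam x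

lemma norm_one_div_two_mul {T : ℝ} (hT : 0 < T) : ‖1 / (2 * (T : ℂ))‖ = 1 / (2 * T) := by
  simp [abs_of_pos hT]

lemma norm_integral_mul_osc_le {g : ℝ → ℂ} {K : ℝ} (hK : ∀ x, ‖g x‖ ≤ K) (lam a b : ℝ) :
    ‖∫ x in a..b, g x * osc lam x‖ ≤ K * |b - a| :=
  intervalIntegral.norm_integral_le_of_norm_le_const fun x _ => by
    rw [norm_mul, norm_osc, mul_one]
    exact hK x

lemma norm_meanR_le {g : ℝ → ℂ} {K T : ℝ} (hK : ∀ x, ‖g x‖ ≤ K) (lam : ℝ) (hT : 0 < T) :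
    ‖meanR g lam T‖ ≤ K := by
  have h := norm_integral_mul_osc_le hK lam (-T) T
  rw [sub_neg_eq_add, abs_of_pos (by linarith)] at h
  rw [meanR, norm_mul, norm_one_div_two_mul hT, one_div, inv_mul_le_iff₀ (by positivity)]
  linarith

lemma osc_neg_mul_osc (lam x : ℝ) : osc (-lam) x * osc lam x = 1 := by
  simp [osc, ← Complex.exp_add]

lemma osc_mul_osc (lam mu x : ℝ) : osc lam x * osc mu x = osc (lam + mu) x := by
  simp only [osc, ← Complex.exp_add]
  congr 1
  push_cast
  ring

lemma norm_osc_neg_sub_one (lam t : ℝ) : ‖osc (-lam) t - 1‖ = ‖osc lam t - 1‖ := by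
  have h : osc (-lam) t - 1 = osc (-lam) t * (1 - osc lam t) := by
    rw [mul_sub, osc_neg_mul_osc, mul_one]
  rw [h, norm_mul, norm_osc, one_mul, norm_sub_rev]

lemma norm_osc_sub_one_mul_meanR_le {g : ℝ → ℂ} (hg : Continuous g) {K ε t T : ℝ}
    (hK : ∀ x, ‖g x‖ ≤ K) (ht : ∀ x, ‖g x - g (x + t)‖ ≤ ε) (lam : ℝ) (hT : 0 < T) :
    ‖osc lam t - 1‖ * ‖meanR g lam T‖ ≤ ε + K * |t| / T := by
  have hi : ∀ {h : ℝ → ℂ}, Continuous h → ∀ a b : ℝ,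
      IntervalIntegrable (fun x => h x * osc lam x) volume a b :=
    fun hh a b => (hh.mul (continuous_osc lam)).intervalIntegrable a b
  have e1 := intervalIntegral.integral_add_adjacent_intervals (hi hg (-T) (-T + t))
    (hi hg (-T + t) (T + t))
  have e2 := intervalIntegral.integral_add_adjacent_intervals (hi hg (-T) T) (hi hg T (T + t))
  have e3 := integral_osc_shift lam (-T) T t g
  have e4 : ∫ x in (-T)..T, (g x - g (x + t)) * osc lam x =
      (∫ x in (-T)..T, g x * osc lam x) - ∫ x in (-T)..T, g (x + t) * osc lam x := by
    rw [← intervalIntegral.integral_sub (hi hg _ _) (hi (by fun_prop) _ _)]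
    simp only [sub_mul]
  have e : (osc lam t - 1) * ∫ x in (-T)..T, g x * osc lam x =
      osc lam t * (∫ x in (-T)..T, (g x - g (x + t)) * osc lam x) +
        ((∫ x in T..(T + t), g x * osc lam x) - ∫ x in (-T)..(-T + t), g x * osc lam x) := by
    rw [e4]
    linear_combination e1 - e2 - e3
  have n1 := norm_integral_mul_osc_le ht lam (-T) T
  have n2 := norm_integral_mul_osc_le hK lam T (T + t)
  have n3 := norm_integral_mul_osc_le hK lam (-T) (-T + t)
  rw [sub_neg_eq_add, abs_of_pos (by linarith)] at n1
  rw [add_sub_cancel_left] at n2 n3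
  have hn : ‖osc lam t - 1‖ * ‖∫ x in (-T)..T, g x * osc lam x‖ ≤
      ε * (T + T) + (K * |t| + K * |t|) := by
    rw [← norm_mul, e]
    refine (norm_add_le _ _).trans (add_le_add ?_ ((norm_sub_le _ _).trans (add_le_add n2 n3)))
    rwa [norm_mul, norm_osc, one_mul]
  rw [meanR, norm_mul, norm_one_div_two_mul hT, mul_left_comm, one_div,
    inv_mul_le_iff₀ (by positivity)]
  refine hn.trans_eq ?_
  field_simp
  ring

lemma meanR_osc_neg_self (lam : ℝ) {T : ℝ} (hT : 0 < T) : meanR (osc (-lam)) lam T = 1 := by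
  have hT' : (T : ℂ) ≠ 0 := by exact_mod_cast hT.ne'
  simp only [meanR, osc_neg_mul_osc, intervalIntegral.integral_const]
  rw [Complex.real_smul]
  push_cast
  field_simp
  ring

lemma tendsto_meanR_osc {lam mu : ℝ} (h : lam ≠ mu) :
    Tendsto (meanR (osc (-mu)) lam) atTop (𝓝 0) := by
  have hc : -(2 * (Real.pi : ℂ) * Complex.I * ((-mu + lam : ℝ) : ℂ)) ≠ 0 := by
    have : ((-mu + lam : ℝ) : ℂ) ≠ 0 := by
      rw [Complex.ofReal_ne_zero]
      exact fun h' => h (by linarith)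
    simpa [Real.pi_ne_zero, Complex.I_ne_zero] using this
  set c := -(2 * (Real.pi : ℂ) * Complex.I * ((-mu + lam : ℝ) : ℂ)) with hcd
  refine squeeze_zero_norm' ?_ (tendsto_const_div_atTop (1 / ‖c‖))
  filter_upwards [Ioi_mem_atTop 0] with T (hT : 0 < T)
  have e : ∀ x : ℝ, osc (-mu) x * osc lam x = Complex.exp (c * x) := fun x => by
    rw [osc_mul_osc]
    simp only [osc, hcd, neg_mul]
  have n : ∀ x : ℝ, ‖Complex.exp (c * x)‖ = 1 := fun x => by
    rw [← e, norm_mul, norm_osc, norm_osc, one_mul]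
  simp only [meanR, e]
  rw [integral_exp_mul_complex hc, norm_mul, norm_one_div_two_mul hT, norm_div]
  have := norm_sub_le (Complex.exp (c * T)) (Complex.exp (c * ((-T : ℝ) : ℂ)))
  rw [n, n] at this
  calc _ ≤ 1 / (2 * T) * ((1 + 1) / ‖c‖) := by gcongr
    _ = 1 / ‖c‖ / T := by field_simp; norm_num

theorem APR.eq_sum_of_finite_spec {g : ℝ → ℂ} (hg : APR g) (S : Finset ℝ)
    (hS : ∀ lam ∉ S, Tendsto (meanR g lam) atTop (𝓝 0)) :
    ∃ c : ℝ → ℂ, ∀ x, g x = ∑ lam ∈ S, c lam * osc (-lam) x := by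
  obtain ⟨K, hK0, hK⟩ := hg.bounded
  set U : Ultrafilter ℝ := Ultrafilter.of atTop with hUd
  have hU : (U : Filter ℝ) ≤ atTop := Ultrafilter.of_le atTop
  have hex : ∀ lam, ∃ c : ℂ, Tendsto (meanR g lam) U (𝓝 c) := by
    intro lam
    obtain ⟨c, -, hc⟩ := (isCompact_closedBall (0 : ℂ) K).ultrafilter_le_nhds
      (U.map (meanR g lam)) (by
        rw [le_principal_iff, Ultrafilter.coe_map, mem_map]
        filter_upwards [hU (Ioi_mem_atTop 0)] with T hT
        simpa using norm_meanR_le hK lam hT)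
    exact ⟨c, hc⟩
  choose c hc using hex
  have htr : ∀ (lam t ε : ℝ), (∀ x, ‖g x - g (x + t)‖ ≤ ε) → ‖osc lam t - 1‖ * ‖c lam‖ ≤ ε := by
    intro lam t ε ht
    have h1 := (hc lam).norm.const_mul ‖osc lam t - 1‖
    have h2 := (tendsto_const_div_atTop (K * |t|)).const_add ε
    rw [add_zero] at h2
    refine le_of_tendsto_of_tendsto h1 (h2.mono_left hU) ?_
    filter_upwards [hU (Ioi_mem_atTop 0)] with T hT
    exact norm_osc_sub_one_mul_meanR_le hg.1 hK ht lam hT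
  set ψ : ℝ → ℂ := fun x => g x - ∑ lam ∈ S, c lam * osc (-lam) x with hψ
  have hsc : Continuous fun x => ∑ lam ∈ S, c lam * osc (-lam) x :=
    continuous_finsetSum _ fun lam _ => continuous_const.mul (continuous_osc _)
  have hψAP : APR ψ := by
    refine ⟨hg.1.sub hsc, fun ε hε => ?_⟩
    obtain ⟨l, hl, h⟩ := hg.2 (ε / (S.card + 1)) (by positivity)
    refine ⟨l, hl, fun x => ?_⟩
    obtain ⟨t, ht, hxt⟩ := h x
    refine ⟨t, fun y => ?_, hxt⟩
    have e : ψ y - ψ (y + t) = (g y - g (y + t)) +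
        ∑ lam ∈ S, c lam * osc (-lam) y * (osc (-lam) t - 1) := by
      simp only [hψ, osc_add, mul_sub, mul_one, Finset.sum_sub_distrib, mul_assoc]
      ring
    rw [e]
    calc _ ≤ ε / (S.card + 1) + ∑ lam ∈ S, ε / (S.card + 1) := by
          refine (norm_add_le _ _).trans (add_le_add (ht y) ?_)
          refine (norm_sum_le _ _).trans (Finset.sum_le_sum fun lam _ => ?_)
          rw [norm_mul, norm_mul, norm_osc, mul_one, norm_osc_neg_sub_one, mul_comm]
          exact htr lam t _ ht
      _ = ε := by
          rw [Finset.sum_const, nsmul_eq_mul]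
          field_simp
          ring
  have hmean : ∀ lam T, meanR ψ lam T =
      meanR g lam T - ∑ mu ∈ S, c mu * meanR (osc (-mu)) lam T := by
    intro lam T
    simp only [meanR, hψ, sub_mul, Finset.sum_mul]
    rw [intervalIntegral.integral_sub, intervalIntegral.integral_finsetSum, mul_sub,
      Finset.mul_sum]
    · congr 1
      refine Finset.sum_congr rfl fun mu _ => ?_
      simp only [mul_assoc]
      rw [intervalIntegral.integral_const_mul]
      ring
    · exact fun mu _ => ((continuous_const.mul (continuous_osc _)).mul
        (continuous_osc _)).intervalIntegrable _ _
    · exact (hg.1.mul (continuous_osc _)).intervalIntegrable _ _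
    · refine Continuous.intervalIntegrable ?_ _ _
      exact continuous_finsetSum _ fun mu _ =>
        (continuous_const.mul (continuous_osc _)).mul (continuous_osc _)
  have hzero : ∀ lam, Tendsto (meanR ψ lam) U (𝓝 0) := by
    intro lam
    have hosc : ∀ mu, Tendsto (fun T => c mu * meanR (osc (-mu)) lam T) U
        (𝓝 (if mu = lam then c lam else 0)) := by
      intro mu
      split_ifs with h
      · subst h
        refine tendsto_const_nhds.congr' ?_
        filter_upwards [hU (Ioi_mem_atTop 0)] with T hT
        rw [meanR_osc_neg_self mu hT, mul_one]
      · simpa using ((tendsto_meanR_osc (Ne.symm h)).mono_left hU).const_mul (c mu)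
    have h := (hc lam).sub (tendsto_finsetSum S fun mu _ => hosc mu)
    rw [Finset.sum_ite_eq' S lam] at h
    have h0 : c lam - (if lam ∈ S then c lam else 0) = 0 := by
      split_ifs with hmem
      · exact sub_self _
      · rw [sub_zero]
        exact tendsto_nhds_unique (hc lam) ((hS lam hmem).mono_left hU)
    rw [h0] at h
    exact h.congr fun T => (hmean lam T).symm
  refine ⟨c, fun x => sub_eq_zero.1 ?_⟩
  exact hψAP.eq_zero (fun lam => freqMeanZero_of_tendsto hU (hzero lam)) x

lemma eq_of_eq_on_horizontal_line {g h : ℂ → ℂ} (hg : Differentiable ℂ g)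
    (hh : Differentiable ℂ h) {y : ℝ}
    (e : ∀ x : ℝ, g ((x : ℂ) + (y : ℂ) * Complex.I) = h ((x : ℂ) + (y : ℂ) * Complex.I)) :
    g = h := by
  have hga : AnalyticOnNhd ℂ g univ := fun z _ => hg.analyticAt z
  have hha : AnalyticOnNhd ℂ h univ := fun z _ => hh.analyticAt z
  refine hga.eq_of_frequently_eq (z₀ := (y : ℂ) * Complex.I) hha ?_
  have hm : Tendsto (fun x : ℝ => (x : ℂ) + (y : ℂ) * Complex.I) (𝓝[≠] 0)
      (𝓝[≠] ((y : ℂ) * Complex.I)) := by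
    refine tendsto_nhdsWithin_iff.2 ⟨?_, ?_⟩
    · have hc : Continuous fun x : ℝ => (x : ℂ) + (y : ℂ) * Complex.I := by fun_prop
      have := hc.tendsto 0
      rw [Complex.ofReal_zero, zero_add] at this
      exact this.mono_left nhdsWithin_le_nhds
    · filter_upwards [self_mem_nhdsWithin] with x (hx : x ≠ 0)
      simpa using hx
  exact hm.frequently (Eventually.of_forall e).frequently

theorem APH.isTrigPoly {f : ℂ → ℂ} (hAP : APH f) (hf : Differentiable ℂ f)
    (hfin : (specH f).Finite) : IsTrigPoly f := by
  obtain ⟨c, hc⟩ := (hAP.apr one_pos).eq_sum_of_finite_spec hfin.toFinset fun lam hlam => by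
    refine tendsto_meanR_of_tendsto_meanAt ?_
    rw [Set.Finite.mem_toFinset] at hlam
    by_contra hcon
    exact hlam ⟨1, one_pos, hcon⟩
  set S := hfin.toFinset
  have key : f = fun z => ∑ lam ∈ S, c lam * Complex.exp (2 * Real.pi * lam) *
      Complex.exp (2 * (Real.pi : ℂ) * Complex.I * (lam : ℂ) * z) := by
    refine eq_of_eq_on_horizontal_line hf (by fun_prop) (y := 1) fun x => ?_
    rw [hc x]
    refine Finset.sum_congr rfl fun lam _ => ?_
    rw [mul_assoc, ← Complex.exp_add, osc]
    congr 2
    push_cast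
    linear_combination (-2 * (Real.pi : ℂ) * lam) * Complex.I_sq
  let e := S.equivFin
  refine ⟨S.card, fun n => c (e.symm n) * Complex.exp (2 * Real.pi * ((e.symm n : ℝ) : ℂ)),
    fun n => e.symm n, fun z => ?_⟩
  rw [key]
  simp only
  rw [← Finset.sum_coe_sort]
  exact (Equiv.sum_comp e.symm _).symm

/-- Lemma 5.6: an entire function with `f, f* ∈ AP(ℍ)`, spectra bounded below, and finite
order has finite exponential type `τ = max{ϑ(f), ϑ(f*)}`, is bounded on ℝ with
`|f(x+iy)| ≤ M e^{τ|y|}`, has `ℰf(λ) = conj(ℰf*(-λ))` and spectrum in `[-τ/2π, τ/2π]`;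
if the spectrum is locally finite, `f` is a trigonometric polynomial. -/
theorem stmt19 (f : ℂ → ℂ) (hf : Differentiable ℂ f)
    (hAP : APH f) (hAPs : APH (fstar f))
    (hb1 : BddBelow (specH f)) (hb2 : BddBelow (specH (fstar f)))
    (horder : ∃ ρ > (0:ℝ), ∃ C c : ℝ, ∀ z : ℂ, ‖f z‖ ≤ C * Real.exp (c * ‖z‖ ^ ρ)) :
    Filter.IsBoundedUnder (· ≤ ·) (Filter.comap (fun z : ℂ => ‖z‖) atTop)
        (fun z : ℂ => Real.log ‖f z‖ / ‖z‖) ∧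
    Filter.limsup (fun z : ℂ => Real.log ‖f z‖ / ‖z‖)
        (Filter.comap (fun z : ℂ => ‖z‖) atTop)
      = max (MeanType f) (MeanType (fstar f)) ∧
    BoundedType f ∧ BoundedType (fstar f) ∧
    BddAbove (Set.range fun x : ℝ => ‖f (x : ℂ)‖) ∧
    (∀ x y : ℝ, ‖f ((x : ℂ) + (y : ℂ) * Complex.I)‖ ≤
      (⨆ x' : ℝ, ‖f ((x' : ℂ))‖) *
        Real.exp (max (MeanType f) (MeanType (fstar f)) * |y|)) ∧
    (∀ (lam y : ℝ) (cv : ℂ), 0 < y →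
      (HasMeanAt f y lam cv ↔ HasMeanAt (fstar f) y (-lam) ((starRingEnd ℂ) cv))) ∧
    specH f = (fun x : ℝ => -x) '' specH (fstar f) ∧
    specH f ⊆ Set.Icc (-(max (MeanType f) (MeanType (fstar f)) / (2 * Real.pi)))
        (max (MeanType f) (MeanType (fstar f)) / (2 * Real.pi)) ∧
    (LocFinSet (specH f) → IsTrigPoly f) := by
  obtain ⟨C, -, B, hB, hC⟩ := exists_norm_le_exp_im hf hAP hAPs hb1 hb2 horder
  have hbdd : BddAbove (Set.range fun x : ℝ => ‖f (x : ℂ)‖) := by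
    refine ⟨C, ?_⟩
    rintro _ ⟨x, rfl⟩
    simpa using hC x
  have hM : ∀ x : ℝ, ‖f x‖ ≤ ⨆ x' : ℝ, ‖f (x' : ℂ)‖ := fun x => le_ciSup hbdd x
  have hfs := differentiable_fstar hf
  have hCs := norm_fstar_le hC
  have hle := norm_le_exp_max_meanType hf hB hC hM
  have hτ := max_meanType_nonneg hf hB hC hM
  have hles := norm_fstar_le hle
  have hspec : specH f = (fun x : ℝ => -x) '' specH (fstar f) := by
    ext lam
    rw [Set.image_neg_eq_neg, Set.mem_neg, mem_specH_fstar_iff hf hB hC]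
  have hsub : specH f ⊆ Set.Icc (-(max (MeanType f) (MeanType (fstar f)) / (2 * Real.pi)))
      (max (MeanType f) (MeanType (fstar f)) / (2 * Real.pi)) := fun lam hlam =>
    ⟨le_of_mem_specH hf hτ hle hlam,
      neg_le_neg_iff.1 (le_of_mem_specH hfs hτ hles ((mem_specH_fstar_iff hf hB hC lam).2 hlam))⟩
  refine ⟨isBoundedUnder_log_div hB hC, limsup_log_div_eq hf hB hC hM,
    boundedType_of_norm_le hf hB hC, boundedType_of_norm_le hfs hB hCs, hbdd, fun x y => ?_,
    fun lam y cv hy => hasMeanAt_fstar_iff hf hB hC hy lam cv, hspec, hsub, fun hloc => ?_⟩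
  · simpa using hle ((x : ℂ) + (y : ℂ) * Complex.I)
  · exact hAP.isTrigPoly hf ((hloc _ _).subset fun lam hlam => ⟨hlam,
      (sub_one_lt _).trans_le (hsub hlam).1, (hsub hlam).2.trans_lt (lt_add_one _)⟩)
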